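/- Let 1 ≤ P, 2P ≤ L, 0 < v < 1/2, and γ ∈ ℝ. Let T_γ be the weighted parallel-update TASEP matrix. Then for every t ∈ ℕ and all configurations X and Y: (T_γ^t)(X,Y) = (1+λ)^{N_c(X)−P} · Σ_{n ∈ ℤ^P} e^{γ Σ_{j=1}^P (x_j − y_j + L n_j)} (−1)^{(P−1)(n_1+⋯+n_P)} Σ_{σ ∈ S_P} sgn(σ) ∏_{i=1}^P f( i − σ(i) + P n_i − (n_1+⋯+n_P), x_i − y_{σ(i)} + n_i L, t ), where only finitely many summands over n are nonzero. -/

import Mathlib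

open Classical

/-- `f(a,b,t)` from the paper: `(1+λ)^{-t} (2πi)^{-1} ∮_{|z|=r} (1+λz)^{t+a}(z-1)^{-a}z^{a-b-1} dz`. -/
noncomputable def fInt (lam r : ℝ) (a b : ℤ) (t : ℕ) : ℂ :=
  ((1 : ℂ) + (lam : ℂ)) ^ (-(t : ℤ)) *
    ((2 * (Real.pi : ℂ) * Complex.I)⁻¹ *
      ∮ z in C(0, r), (1 + (lam : ℂ) * z) ^ ((t : ℤ) + a) * (z - 1) ^ (-a) * z ^ (a - b - 1))

/-- A configuration of `P` particles on a ring of `L` sites: `1 ≤ x₁ < x₂ < ⋯ < x_P ≤ L`. -/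
def IsConfig (L P : ℕ) (X : Fin P → ℤ) : Prop :=
  StrictMono X ∧ ∀ i, 1 ≤ X i ∧ X i ≤ L

/- Number of clusters: the number of particles whose cyclic successor site is empty. -/
noncomputable def Nc (L : ℕ) {P : ℕ} (X : Fin P → ℤ) : ℕ :=
  (Finset.univ.filter fun i : Fin P =>
    ∀ j : Fin P, X j ≠ (if X i = (L : ℤ) then 1 else X i + 1)).card

/-- The cyclic successor of a site on the ring of `L` sites. -/
def succSite (L : ℕ) (s : ℤ) : ℤ := if s = (L : ℤ) then 1 else s + 1

/-- The weighted parallel-update TASEP matrix: jumps carry an extra weight `e^γ` each. -/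
noncomputable def Tgamma (v γ : ℝ) (L P : ℕ) (X X' : Fin P → ℤ) : ℝ :=
  if IsConfig L P X ∧ IsConfig L P X' then
    ∑ M : Finset (Fin P),
      if (∀ i ∈ M, ∀ j, X' j ≠ succSite L (X' i)) ∧
          (Finset.image X Finset.univ =
            Finset.image (fun i => if i ∈ M then succSite L (X' i) else X' i) Finset.univ)
        then Real.exp (γ * M.card) * v ^ M.card * (1 - v) ^ ((Nc L X' : ℤ) - M.card)
      else 0
  else 0

/-- Powers of the weighted matrix: `(T_γ^t)(X,Y) = Σ T_γ(X,X_{t-1})⋯T_γ(X₁,Y)`. -/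
noncomputable def Tgpow (v γ : ℝ) (L P : ℕ) : ℕ → (Fin P → ℤ) → (Fin P → ℤ) → ℝ
  | 0 => fun X Y => if X = Y then 1 else 0
  | t + 1 => fun X Y => ∑' Z : Fin P → ℤ, Tgamma v γ L P X Z * Tgpow v γ L P t Z Y

/-- The summand over `n ∈ ℤ^P` in the Bethe-ansatz expansion of `(T_γ^t)(X,Y)`. -/
noncomputable def summand1 (lam r γ : ℝ) (L : ℕ) {P : ℕ} (X Y : Fin P → ℤ) (t : ℕ)
    (n : Fin P → ℤ) : ℂ :=
  Complex.exp ((γ : ℂ) * ((∑ j, (X j - Y j + (L : ℤ) * n j) : ℤ) : ℂ)) *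
    (-1 : ℂ) ^ (((P : ℤ) - 1) * ∑ i, n i) *
    ∑ σ : Equiv.Perm (Fin P), ((Equiv.Perm.sign σ : ℤ) : ℂ) *
      ∏ i : Fin P, fInt lam r
        (((i : ℕ) : ℤ) - ((σ i : ℕ) : ℤ) + (P : ℤ) * n i - ∑ k, n k)
        (X i - Y (σ i) + n i * L) t


/-- general contour integral -/
noncomputable def cI (lam r : ℝ) (c d e : ℤ) : ℂ :=
  (2 * (Real.pi : ℂ) * Complex.I)⁻¹ *
      ∮ z in C(0, r), (1 + (lam : ℂ) * z) ^ c * (z - 1) ^ d * z ^ e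

lemma circ_ne {lam r : ℝ} (h0 : 0 < lam) (h1 : 1 < r) (h2 : lam * r < 1) {z : ℂ} (hz : z ∈ Metric.sphere (0:ℂ) r) :
    z ≠ 0 ∧ z - 1 ≠ 0 ∧ 1 + (lam:ℂ) * z ≠ 0 := by
  have hn : ‖z‖ = r := by simpa using hz
  refine ⟨?_, ?_, ?_⟩
  · rintro rfl; simp at hn; linarith
  · intro h
    have : z = 1 := by linear_combination h
    subst this; simp at hn; linarith
  · intro h
    have : (lam:ℂ) * z = -1 := by linear_combination h
    have h3 := congrArg norm this
    rw [norm_mul, hn] at h3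
    simp [abs_of_pos h0] at h3
    linarith

lemma cI_int {lam r : ℝ} (h0 : 0 < lam) (h1 : 1 < r) (h2 : lam * r < 1) (c d e : ℤ) :
    CircleIntegrable (fun z : ℂ => (1 + (lam : ℂ) * z) ^ c * (z - 1) ^ d * z ^ e) 0 r := by
  apply ContinuousOn.circleIntegrable (by linarith)
  intro z hz
  obtain ⟨a, b, c⟩ := circ_ne h0 h1 h2 hz
  apply ContinuousAt.continuousWithinAt
  refine ContinuousAt.mul (ContinuousAt.mul ?_ ?_) ?_
  · exact ContinuousAt.zpow₀ (by fun_prop) _ (Or.inl c)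
  · exact ContinuousAt.zpow₀ (by fun_prop) _ (Or.inl b)
  · exact ContinuousAt.zpow₀ (by fun_prop) _ (Or.inl a)

/-- linear relation -/
lemma cI_rel {lam r : ℝ} (h0 : 0 < lam) (h1 : 1 < r) (h2 : lam * r < 1) (c d e c1 d1 e1 c2 d2 e2 : ℤ) (α β : ℂ)
    (h : ∀ z : ℂ, z ≠ 0 → z - 1 ≠ 0 → 1 + (lam:ℂ) * z ≠ 0 →
      (1 + (lam : ℂ) * z) ^ c * (z - 1) ^ d * z ^ e =
      α * ((1 + (lam : ℂ) * z) ^ c1 * (z - 1) ^ d1 * z ^ e1) + β * ((1 + (lam : ℂ) * z) ^ c2 * (z - 1) ^ d2 * z ^ e2)) :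
    cI lam r c d e = α * cI lam r c1 d1 e1 + β * cI lam r c2 d2 e2 := by
  unfold cI
  have : (∮ z in C(0, r), (1 + (lam : ℂ) * z) ^ c * (z - 1) ^ d * z ^ e) =
     ∮ z in C(0, r), (α * ((1 + (lam : ℂ) * z) ^ c1 * (z - 1) ^ d1 * z ^ e1) + β * ((1 + (lam : ℂ) * z) ^ c2 * (z - 1) ^ d2 * z ^ e2)) := by
    apply circleIntegral.integral_congr (by linarith)
    intro z hz
    obtain ⟨a, b, c⟩ := circ_ne h0 h1 h2 hz
    exact h z a b c
  rw [this, circleIntegral.integral_add, circleIntegral.integral_const_mul, circleIntegral.integral_const_mul]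
  · ring
  · exact IntervalIntegrable.const_mul (cI_int h0 h1 h2 c1 d1 e1) α
  · exact IntervalIntegrable.const_mul (cI_int h0 h1 h2 c2 d2 e2) β

lemma cI_low {lam r : ℝ} (h0 : 0 < lam) (h1 : 1 < r) (h2 : lam * r < 1) (c d e : ℤ) (hd : 0 ≤ d) (he : 0 ≤ e) :
    cI lam r c d e = 0 := by
  unfold cI
  rw [mul_eq_zero]; right
  apply DiffContOnCl.circleIntegral_eq_zero (by linarith)
  apply DifferentiableOn.diffContOnCl
  rw [closure_ball _ (by linarith)]
  intro z hz
  have hn : ‖z‖ ≤ r := by simpa using hz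
  have hc : 1 + (lam:ℂ) * z ≠ 0 := by
    intro h
    have : (lam:ℂ) * z = -1 := by linear_combination h
    have h3 := congrArg norm this
    rw [norm_mul] at h3
    simp [abs_of_pos h0] at h3
    nlinarith
  apply DifferentiableAt.differentiableWithinAt
  refine DifferentiableAt.mul (DifferentiableAt.mul ?_ ?_) ?_
  · exact DifferentiableAt.zpow (by fun_prop) (Or.inl hc)
  · exact DifferentiableAt.zpow (by fun_prop) (Or.inr hd)
  · exact DifferentiableAt.zpow (by fun_prop) (Or.inr he)

lemma cI_z {lam r : ℝ} (h1 : 1 < r) (e : ℤ) :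
    cI lam r 0 0 e = if e = -1 then 1 else 0 := by
  unfold cI
  split_ifs with h
  · subst h
    have := circleIntegral.integral_sub_center_inv (0:ℂ) (R := r) (by linarith)
    simp only [sub_zero] at this
    simp only [zpow_zero, one_mul, zpow_neg_one, this]
    have := Complex.two_pi_I_ne_zero
    field_simp
  · have := circleIntegral.integral_sub_zpow_of_ne h (0:ℂ) (0:ℂ) r
    simp only [sub_zero] at this
    simp [this]

lemma cI_z1 {lam r : ℝ} (h1 : 1 < r) (e : ℤ) :
    cI lam r 0 e 0 = if e = -1 then 1 else 0 := by
  unfold cI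
  split_ifs with h
  · subst h
    have := circleIntegral.integral_sub_inv_of_mem_ball (c := (0:ℂ)) (w := (1:ℂ)) (R := r) (by simpa using h1)
    simp only [zpow_zero, one_mul, zpow_neg_one, this, mul_one]
    have := Complex.two_pi_I_ne_zero
    field_simp
  · have := circleIntegral.integral_sub_zpow_of_ne h (0:ℂ) (1:ℂ) r
    simp [this]

lemma cI_high0 {lam r : ℝ} (h0 : 0 < lam) (h1 : 1 < r) (h2 : lam * r < 1) (m : ℕ) :
    ∀ e : ℤ, e - m ≤ -2 → cI lam r 0 (-m) e = 0 := by
  have rel : ∀ d e : ℤ, cI lam r 0 d (e+1) = 1 * cI lam r 0 d e + 1 * cI lam r 0 (d+1) e := by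
    intro d e
    apply cI_rel h0 h1 h2
    intro z a b c
    rw [zpow_add_one₀ a, zpow_add_one₀ b]; ring
  induction m with
  | zero =>
    intro e he
    simp only [Nat.cast_zero, neg_zero]
    rw [cI_z h1, if_neg (by simp at he; omega)]
  | succ m ih =>
    have cst : ∀ k : ℕ, cI lam r 0 (-(m+1:ℕ)) ((m:ℤ) - 1 - k) = cI lam r 0 (-(m+1:ℕ)) ((m:ℤ) - 1) := by
      intro k
      induction k with
      | zero => simp
      | succ k ihk =>
        rw [← ihk]
        have := rel (-(m+1:ℕ)) ((m:ℤ) - 1 - (k+1:ℕ))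
        rw [show -((m+1:ℕ):ℤ) + 1 = -(m:ℤ) by push_cast; ring, ih _ (by push_cast; omega)] at this
        rw [show ((m:ℤ) - 1 - (k+1:ℕ)) + 1 = (m:ℤ) - 1 - k by push_cast; ring] at this
        rw [this]; ring
    have key : cI lam r 0 (-(m+1:ℕ)) ((m:ℤ) - 1) = 0 := by
      rcases Nat.eq_zero_or_pos m with rfl | hm
      · have := rel (-1) (-1)
        simp only [neg_add_cancel] at this
        rw [cI_z h1, cI_z1 h1] at this
        simp at this
        simpa using this
      · have := cst (m-1)
        rw [← this, show (m:ℤ) - 1 - (m-1:ℕ) = 0 by omega, cI_z1 h1, if_neg (by omega)]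
    intro e he
    have := cst ((m:ℤ) - 1 - e).toNat
    rw [show (m:ℤ) - 1 - ((m:ℤ) - 1 - e).toNat = e by push_cast at he; omega] at this
    rw [this, key]

lemma cI_high1 {lam r : ℝ} (h0 : 0 < lam) (h1 : 1 < r) (h2 : lam * r < 1) (m : ℕ) :
    ∀ e : ℤ, e + m ≤ -2 → cI lam r 0 m e = 0 := by
  induction m with
  | zero =>
    intro e he
    simp only [Nat.cast_zero]
    rw [cI_z h1, if_neg (by simp at he; omega)]
  | succ m ih =>
    intro e he
    have : cI lam r 0 (m+1:ℕ) e = 1 * cI lam r 0 m (e+1) + (-1) * cI lam r 0 m e := by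
      apply cI_rel h0 h1 h2
      intro z a b c
      push_cast
      rw [zpow_add_one₀ a, zpow_add_one₀ b]; ring
    rw [this, ih _ (by push_cast at he; omega), ih _ (by push_cast at he; omega)]; ring

lemma cI_high {lam r : ℝ} (h0 : 0 < lam) (h1 : 1 < r) (h2 : lam * r < 1) (c : ℕ) :
    ∀ d e : ℤ, c + d + e ≤ -2 → cI lam r c d e = 0 := by
  induction c with
  | zero =>
    intro d e h
    rcases le_total 0 d with hd | hd
    · obtain ⟨m, rfl⟩ := Int.eq_ofNat_of_zero_le hd
      exact cI_high1 h0 h1 h2 m e (by simp at h; omega)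
    · obtain ⟨m, hm⟩ := Int.eq_ofNat_of_zero_le (Int.neg_nonneg.mpr hd)
      obtain rfl : d = -m := by omega
      exact cI_high0 h0 h1 h2 m e (by simp at h; omega)
  | succ c ih =>
    intro d e h
    push_cast at h
    have : cI lam r (c+1:ℕ) d e = 1 * cI lam r c d e + lam * cI lam r c d (e+1) := by
      apply cI_rel h0 h1 h2
      intro z a b c
      push_cast
      rw [zpow_add_one₀ a, zpow_add_one₀ c]; ring
    rw [this, ih _ _ (by omega), ih _ _ (by omega)]; ring

/-- The abstract properties of the kernel. -/
structure QProps (q : ℤ → ℤ → ℤ → ℂ) (mu c : ℂ) : Prop where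
  ev : ∀ t a b, q (t+1) a b = q t a b + mu * q t a (b-1)
  rw2 : ∀ t a b, q (t+1) (a+1) (b+1) = mu * q (t+1) a b + c * q t (a+1) (b+1)
  low : ∀ t a b, a ≤ 0 → b < a → q t a b = 0
  high : ∀ t a b, 0 ≤ t + a → t + a < b → q t a b = 0
  z0 : q 0 0 0 = 1
  z1 : q (-1) 0 0 = 1

noncomputable def qq (lam r γ : ℝ) (t a b : ℤ) : ℂ :=
  Complex.exp (γ * b) * cI lam r (t + a) (-a) (a - b - 1)

lemma qq_props {lam r : ℝ} (γ : ℝ) (h0 : 0 < lam) (h1 : 1 < r) (h2 : lam * r < 1) :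
    QProps (qq lam r γ) (lam * Complex.exp γ) (1 + lam) where
  ev t a b := by
    unfold qq
    have : cI lam r (t + 1 + a) (-a) (a - b - 1) = 1 * cI lam r (t + a) (-a) (a - b - 1)
       + lam * cI lam r (t + a) (-a) (a - (b-1) - 1) := by
      apply cI_rel h0 h1 h2
      intro z x y w
      rw [show t + 1 + a = t + a + 1 by ring, show a - (b-1) - 1 = a - b - 1 + 1 by ring, zpow_add_one₀ w (t+a), zpow_add_one₀ x (a - b - 1)]
      ring
    rw [this]
    have e : Complex.exp (γ * b) = Complex.exp γ * Complex.exp (γ * (b-1 : ℤ)) := by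
      rw [← Complex.exp_add]; congr 1; push_cast; ring
    rw [e]; ring
  rw2 t a b := by
    unfold qq
    have : cI lam r (t + 1 + (a+1)) (-(a+1)) (a + 1 - (b + 1) - 1) = lam * cI lam r (t + 1 + a) (-a) (a - b - 1)
       + (1 + lam) * cI lam r (t + (a+1)) (-(a+1)) (a + 1 - (b+1) - 1) := by
      apply cI_rel h0 h1 h2
      intro z x y w
      rw [show t + 1 + (a+1) = t + a + 1 + 1 by ring, show t + 1 + a = t + a + 1 by ring, show t + (a + 1) = t + a + 1 by ring,
        show a + 1 - (b+1) - 1 = a - b - 1 by ring, show (-a) = -(a+1) + 1 by ring, zpow_add_one₀ w (t+a+1), zpow_add_one₀ y (-(a+1))]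
      ring
    rw [this]
    have e : Complex.exp (γ * (b + 1 : ℤ)) = Complex.exp γ * Complex.exp (γ * b) := by
      rw [← Complex.exp_add]; congr 1; push_cast; ring
    rw [e]; ring
  low t a b ha hb := by
    unfold qq
    rw [cI_low h0 h1 h2 _ _ _ (by omega) (by omega), mul_zero]
  high t a b ha hb := by
    unfold qq
    obtain ⟨c, hc⟩ := Int.eq_ofNat_of_zero_le ha
    rw [hc, cI_high h0 h1 h2 _ _ _ (by omega), mul_zero]
  z0 := by
    unfold qq
    simp [cI_z h1]
  z1 := by
    unfold qq
    have : cI lam r 0 0 (-1) = 1 * cI lam r (-1) 0 (-1) + lam * cI lam r (-1) 0 0 := by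
      apply cI_rel h0 h1 h2
      intro z x y w
      have w' : 1 + z * (lam:ℂ) ≠ 0 := by rwa [mul_comm]
      simp only [zpow_zero, zpow_neg_one, one_mul, mul_one]
      field_simp
    rw [cI_low h0 h1 h2 (-1) 0 0 le_rfl le_rfl, cI_z h1] at this
    simp at this
    simpa using this.symm


section QQ
variable (q : ℤ → ℤ → ℤ → ℂ) (L : ℕ) {P : ℕ} (Y : Fin P → ℤ)

noncomputable def tm (tau X n : Fin P → ℤ) (σ : Equiv.Perm (Fin P)) : ℂ :=
  ((Equiv.Perm.sign σ : ℤ) : ℂ) *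
      ∏ i : Fin P, q (tau i)
        (((i : ℕ) : ℤ) - ((σ i : ℕ) : ℤ) + (P : ℤ) * n i - ∑ k, n k)
        (X i - Y (σ i) + n i * L)

noncomputable def sm (tau X n : Fin P → ℤ) : ℂ :=
  (-1 : ℂ) ^ (((P : ℤ) - 1) * ∑ i, n i) * ∑ σ : Equiv.Perm (Fin P), tm q L Y tau X n σ

noncomputable def QQ (tau X : Fin P → ℤ) : ℂ := ∑' n : Fin P → ℤ, sm q L Y tau X n

end QQ

lemma sum_lvl {P : ℕ} (n : Fin P → ℤ) (σ : Equiv.Perm (Fin P)) :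
    ∑ i : Fin P, (((i : ℕ) : ℤ) - ((σ i : ℕ) : ℤ) + (P : ℤ) * n i - ∑ k, n k) = 0 := by
  rw [Finset.sum_sub_distrib, Finset.sum_add_distrib, Finset.sum_sub_distrib,
    Equiv.sum_comp σ (fun i : Fin P => ((i:ℕ):ℤ)), ← Finset.mul_sum]
  simp

lemma supp_bound {P L : ℕ} (hP : 1 ≤ P) (hL : P < L) (A T : ℤ) (hT : 0 ≤ T)
    (n δ β a tau : Fin P → ℤ) (S : ℤ) (hS : S = ∑ k, n k)
    (hδ : ∀ i, |δ i| ≤ P) (hβ : ∀ i, |β i| ≤ A) (hA : 0 ≤ A)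
    (ha : ∀ i, a i = δ i + P * n i - S) (hsum : ∑ i, a i = 0)
    (ht1 : ∀ i, -1 ≤ tau i) (ht2 : ∀ i, tau i ≤ T) (ht3 : ∃ i, 0 ≤ tau i)
    (hlow : ∀ i, a i ≤ 0 → a i ≤ β i + n i * L)
    (hhigh : ∀ i, 0 ≤ tau i + a i → β i + n i * L ≤ tau i + a i) :
    ∀ i, |n i| ≤ (T + A + P + L * (2 + T)) * (1 + 2 * P) := by
  have : Nonempty (Fin P) := ⟨⟨0, hP⟩⟩
  obtain ⟨m, hm⟩ := Finite.exists_min n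
  obtain ⟨m', hm'⟩ := Finite.exists_max n
  have hδ1 := fun i => abs_le.mp (hδ i)
  have hβ1 := fun i => abs_le.mp (hβ i)
  have hLP : (1:ℤ) ≤ L - P := by omega
  set C : ℤ := T + A + P + L * (2 + T) with hC
  have e1 : ∃ i, a i ≤ 0 := by
    by_contra hcon
    push Not at hcon
    have : 0 < ∑ i, a i := Finset.sum_pos (fun i _ => hcon i) Finset.univ_nonempty
    omega
  have e2 : ∃ i, 0 ≤ tau i + a i := by
    by_contra hcon
    push Not at hcon
    obtain ⟨k, hk⟩ := ht3
    have : ∑ i, a i < ∑ i : Fin P, (0:ℤ) := by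
      apply Finset.sum_lt_sum
      · intro i _
        have := hcon i; have := ht1 i; omega
      · exact ⟨k, Finset.mem_univ _, by have := hcon k; omega⟩
    simp at this; omega
  have lowgen : ∀ i, a i ≤ 0 → -(A + P) ≤ (L - P) * n i + S := by
    intro i hi
    have := hlow i hi
    rw [ha i] at this
    have := hβ1 i; have := hδ1 i
    nlinarith
  have highgen : ∀ i, 0 ≤ tau i + a i → (L - P) * n i + S ≤ T + A + P := by
    intro i hi
    have := hhigh i hi
    rw [ha i] at this
    have := hβ1 i; have := hδ1 i; have := ht2 i
    nlinarith
  have hPp : (0:ℤ) < P := by omega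
  have LT : (0:ℤ) ≤ L * T := by positivity
  have lo : -C ≤ (L - P) * n m + S := by
    by_cases h : a m ≤ 0
    · have := lowgen m h
      rw [hC]; nlinarith
    · obtain ⟨i, hi⟩ := e1
      have h1 := lowgen i hi
      have h2 := ha m; have h3 := ha i
      have := hδ1 m; have := hδ1 i
      have h4 : n i < n m + 2 := by
        have : (P:ℤ) * n i < P * (n m + 2) := by nlinarith
        exact lt_of_mul_lt_mul_left this hPp.le
      have h5 : (L - P:ℤ) * n i ≤ (L - P) * (n m + 1) := mul_le_mul_of_nonneg_left (by omega) (by omega)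
      rw [hC]; nlinarith
  have hi : (L - P) * n m' + S ≤ C := by
    by_cases h : 0 ≤ tau m' + a m'
    · have := highgen m' h
      rw [hC]; nlinarith
    · obtain ⟨i, hi⟩ := e2
      have h1 := highgen i hi
      have h2 := ha m'; have h3 := ha i
      have := hδ1 m'; have := hδ1 i; have := ht1 m'; have := ht2 i
      have h4 : n m' ≤ n i + (2 + T) := by
        have : (P:ℤ) * n m' ≤ P * (n i + (2 + T)) := by nlinarith
        exact le_of_mul_le_mul_left this hPp
      have h5 : (L - P:ℤ) * n m' ≤ (L - P) * (n i + (2 + T)) := mul_le_mul_of_nonneg_left (by omega) (by omega)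
      rw [hC]; nlinarith
  have dif : n m' - n m ≤ 2 * C := by
    have h1 : (L - P) * (n m' - n m) ≤ 2 * C := by linarith
    have h2 : 0 ≤ n m' - n m := by have := hm m'; omega
    nlinarith
  have S1 : P * n m ≤ S := by
    rw [hS]
    have := Finset.card_nsmul_le_sum Finset.univ n (n m) (fun i _ => hm i)
    simpa using this
  have S2 : S ≤ P * n m' := by
    rw [hS]
    have := Finset.sum_le_card_nsmul Finset.univ n (n m') (fun i _ => hm' i)
    simpa using this
  have hC0 : 0 ≤ C := by rw [hC]; positivity
  have hLp : (0:ℤ) < L := by omega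
  have B1 : n m' ≤ C * (1 + 2 * P) := by
    have : L * n m' ≤ C * (1 + 2 * P) := by nlinarith
    by_cases hneg : n m' ≤ 0
    · have : 0 ≤ C * (1 + 2 * P) := by positivity
      omega
    · nlinarith
  have B2 : -(C * (1 + 2 * P)) ≤ n m := by
    have : -(C * (1 + 2 * P)) ≤ L * n m := by nlinarith
    by_cases hneg : 0 ≤ n m
    · have : 0 ≤ C * (1 + 2 * P) := by positivity
      omega
    · nlinarith
  intro i
  rw [abs_le]
  have := hm i; have := hm' i
  constructor <;> omega

lemma tm_zero {q : ℤ → ℤ → ℤ → ℂ} {mu c : ℂ} (hq : QProps q mu c) {L P : ℕ} (Y tau X n : Fin P → ℤ) (σ : Equiv.Perm (Fin P))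
    (h : tm q L Y tau X n σ ≠ 0) (i : Fin P) :
    ((((i : ℕ) : ℤ) - ((σ i : ℕ) : ℤ) + (P : ℤ) * n i - ∑ k, n k) ≤ 0 →
      (((i : ℕ) : ℤ) - ((σ i : ℕ) : ℤ) + (P : ℤ) * n i - ∑ k, n k) ≤ X i - Y (σ i) + n i * L) ∧
    (0 ≤ tau i + (((i : ℕ) : ℤ) - ((σ i : ℕ) : ℤ) + (P : ℤ) * n i - ∑ k, n k) →
      X i - Y (σ i) + n i * L ≤ tau i + (((i : ℕ) : ℤ) - ((σ i : ℕ) : ℤ) + (P : ℤ) * n i - ∑ k, n k)) := by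
  have h1 := right_ne_zero_of_mul h
  rw [Finset.prod_ne_zero_iff] at h1
  have h2 := h1 i (Finset.mem_univ _)
  constructor
  · intro ha
    by_contra hb
    exact h2 (hq.low _ _ _ ha (by omega))
  · intro ha
    by_contra hb
    exact h2 (hq.high _ _ _ ha (by omega))

lemma tm_fin {q : ℤ → ℤ → ℤ → ℂ} {mu c : ℂ} (hq : QProps q mu c) {L P : ℕ} (hP : 1 ≤ P) (hL : P < L) (Y tau X : Fin P → ℤ)
    (ht1 : ∀ i, -1 ≤ tau i) (ht3 : ∃ i, 0 ≤ tau i) :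
    {n | sm q L Y tau X n ≠ 0}.Finite := by
  set A : ℤ := ∑ i, ∑ j, |X i - Y j| with hA
  set T : ℤ := ∑ i, |tau i| with hT
  have hAb : ∀ i j, |X i - Y j| ≤ A := by
    intro i j
    calc |X i - Y j| ≤ ∑ j, |X i - Y j| := Finset.single_le_sum (f := fun j => |X i - Y j|) (fun _ _ => abs_nonneg _) (Finset.mem_univ j)
      _ ≤ A := Finset.single_le_sum (f := fun i => ∑ j, |X i - Y j|) (fun _ _ => Finset.sum_nonneg (fun _ _ => abs_nonneg _)) (Finset.mem_univ i)
  have hTb : ∀ i, tau i ≤ T := fun i => (le_abs_self _).trans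
    (Finset.single_le_sum (f := fun j => |tau j|) (fun _ _ => abs_nonneg _) (Finset.mem_univ i))
  set B : ℤ := (T + A + P + L * (2 + T)) * (1 + 2 * P)
  apply (Set.Finite.pi (fun _ : Fin P => Set.finite_Icc (-B) B)).subset
  intro n hn
  have h1 := right_ne_zero_of_mul hn
  obtain ⟨σ, -, hσ⟩ := Finset.exists_ne_zero_of_sum_ne_zero h1
  have key := supp_bound hP hL A T (Finset.sum_nonneg (fun _ _ => abs_nonneg _)) n
    (fun i => ((i : ℕ) : ℤ) - ((σ i : ℕ) : ℤ)) (fun i => X i - Y (σ i)) _ tau _ rfl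
    (fun i => by rw [abs_le]; have := i.2; have := (σ i).2; constructor <;> omega) (fun i => hAb _ _)
    (Finset.sum_nonneg (fun _ _ => Finset.sum_nonneg (fun _ _ => abs_nonneg _))) (fun i => rfl) (sum_lvl n σ) ht1 hTb ht3
    (fun i => (tm_zero hq Y tau X n σ hσ i).1) (fun i => (tm_zero hq Y tau X n σ hσ i).2)
  intro i _
  exact abs_le.mp (key i)

lemma row_replace {q : ℤ → ℤ → ℤ → ℂ} {mu c : ℂ} (hq : QProps q mu c) {L P : ℕ} (hP : 1 ≤ P) (hL : P < L) (Y tau X : Fin P → ℤ)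
    (ht1 : ∀ i, -1 ≤ tau i) (p j : Fin P) (hpj : p ≠ j) (ε t : ℤ) (ht : -1 ≤ t) (hp : tau p = t + 1) (hj : tau j = t + 1)
    (h1 : (j : ℤ) = p + 1 - ε * P) (h2 : X j = X p + 1 - ε * L) :
    QQ q L Y tau X = c * QQ q L Y (Function.update tau j t) X := by
  let G : (Fin P → ℤ) → Equiv.Perm (Fin P) → Fin P → ℂ := fun n σ i =>
    if i = j then q (t+1) (((i : ℕ) : ℤ) - ((σ i : ℕ) : ℤ) + (P : ℤ) * n i - ∑ k, n k - 1) (X i - Y (σ i) + n i * L - 1)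
    else q (tau i) (((i : ℕ) : ℤ) - ((σ i : ℕ) : ℤ) + (P : ℤ) * n i - ∑ k, n k) (X i - Y (σ i) + n i * L)
  let D : (Fin P → ℤ) → ℂ := fun n => (-1 : ℂ) ^ (((P : ℤ) - 1) * ∑ i, n i) *
    ∑ σ : Equiv.Perm (Fin P), ((Equiv.Perm.sign σ : ℤ) : ℂ) * ∏ i, G n σ i
  have hD : ∀ n, sm q L Y tau X n = c * sm q L Y (Function.update tau j t) X n + mu * D n := by
    intro n
    have : ∀ σ, tm q L Y tau X n σ = c * tm q L Y (Function.update tau j t) X n σ +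
        mu * (((Equiv.Perm.sign σ : ℤ) : ℂ) * ∏ i, G n σ i) := by
      intro σ
      unfold tm
      rw [← Finset.mul_prod_erase Finset.univ _ (Finset.mem_univ j), ← Finset.mul_prod_erase Finset.univ _ (Finset.mem_univ j),
        ← Finset.mul_prod_erase Finset.univ (G n σ) (Finset.mem_univ j)]
      have e1 : ∏ x ∈ Finset.univ.erase j, q (Function.update tau j t x) (((x : ℕ) : ℤ) - ((σ x : ℕ) : ℤ) + (P : ℤ) * n x - ∑ k, n k) (X x - Y (σ x) + n x * L)
         = ∏ x ∈ Finset.univ.erase j, q (tau x) (((x : ℕ) : ℤ) - ((σ x : ℕ) : ℤ) + (P : ℤ) * n x - ∑ k, n k) (X x - Y (σ x) + n x * L) := by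
        apply Finset.prod_congr rfl
        intro x hx
        rw [Function.update_of_ne (Finset.ne_of_mem_erase hx)]
      have e2 : ∏ x ∈ Finset.univ.erase j, G n σ x
         = ∏ x ∈ Finset.univ.erase j, q (tau x) (((x : ℕ) : ℤ) - ((σ x : ℕ) : ℤ) + (P : ℤ) * n x - ∑ k, n k) (X x - Y (σ x) + n x * L) := by
        apply Finset.prod_congr rfl
        intro x hx
        simp only [G, if_neg (Finset.ne_of_mem_erase hx)]
      rw [e1, e2, Function.update_self]
      have e3 := hq.rw2 t (((j : ℕ) : ℤ) - ((σ j : ℕ) : ℤ) + (P : ℤ) * n j - ∑ k, n k - 1) (X j - Y (σ j) + n j * L - 1)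
      simp only [sub_add_cancel] at e3
      simp only [G, if_true]
      rw [hj, e3]
      ring
    unfold sm
    simp only [D]
    rw [Finset.sum_congr rfl (fun σ _ => this σ), Finset.sum_add_distrib, ← Finset.mul_sum, ← Finset.mul_sum]
    ring
  let sw := Equiv.swap p j
  let e : (Fin P → ℤ) → (Fin P → ℤ) := fun n i => n (sw i) - (if i = p then ε else 0) + (if i = j then ε else 0)
  have hsw1 : sw p = j := Equiv.swap_apply_left _ _
  have hsw2 : sw j = p := Equiv.swap_apply_right _ _
  have hsw3 : ∀ i, i ≠ p → i ≠ j → sw i = i := fun i a b => Equiv.swap_apply_of_ne_of_ne a b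
  have he : Function.Involutive e := by
    intro n
    funext i
    by_cases hip : i = p
    · subst hip; simp [e, hsw1, hsw2, hpj, hpj.symm]
    · by_cases hij : i = j
      · subst hij; simp [e, hsw1, hsw2, hpj, hpj.symm]
      · simp [e, hsw3 i hip hij, hip, hij]
  have hes : ∀ n, ∑ i, e n i = ∑ i, n i := by
    intro n
    simp only [e, Finset.sum_add_distrib, Finset.sum_sub_distrib, Equiv.sum_comp sw n]
    simp
  have hDe : ∀ n, D (e n) = - D n := by
    intro n
    simp only [D, hes]
    rw [← mul_neg, ← Finset.sum_neg_distrib]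
    congr 1
    apply Fintype.sum_equiv (Equiv.mulRight sw)
    intro σ
    have : ∏ i, G (e n) σ i = ∏ i, G n (σ * sw) i := by
      apply Fintype.prod_equiv sw
      intro i
      by_cases hip : i = p
      · subst hip
        simp only [G, hsw1, if_neg hpj, if_true, hes, hp, Equiv.Perm.mul_apply, hsw2]
        simp only [e, hsw1, if_true, if_neg hpj]
        congr 1
        · rw [h1]; ring
        · rw [h2]; ring
      · by_cases hij : i = j
        · subst hij
          simp only [G, hsw2, if_neg hpj, if_true, hes, hp, Equiv.Perm.mul_apply, hsw1]
          simp only [e, hsw2, if_true, if_neg hpj.symm]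
          congr 1
          · rw [h1]; ring
          · rw [h2]; ring
        · simp only [G, hsw3 i hip hij, if_neg hij, hes, Equiv.Perm.mul_apply]
          simp [e, hsw3 i hip hij, hip, hij]
    rw [this]
    simp only [Equiv.coe_mulRight, Equiv.Perm.sign_mul, sw, Equiv.Perm.sign_swap hpj]
    push_cast
    ring
  have hD0 : ∑' n, D n = 0 := by
    have h := Equiv.tsum_eq (Function.Involutive.toPerm e he) D
    have h' : ∑' n, D (Function.Involutive.toPerm e he n) = ∑' n, - D n := tsum_congr (fun n => hDe n)
    rw [h', tsum_neg] at h
    have : (2:ℂ) * ∑' n, D n = 0 := by linear_combination -h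
    simpa using this
  have s1 : Summable (fun n => sm q L Y tau X n) :=
    summable_of_hasFiniteSupport (tm_fin hq hP hL Y tau X ht1 ⟨p, by omega⟩)
  have s2 : Summable (fun n => sm q L Y (Function.update tau j t) X n) := by
    apply summable_of_hasFiniteSupport (tm_fin hq hP hL Y _ X _ ⟨p, _⟩)
    · intro i
      by_cases h : i = j
      · subst h; simpa using ht
      · rw [Function.update_of_ne h]; exact ht1 i
    · rw [Function.update_of_ne hpj]; omega
  have s3 : ∑' n, (mu * D n) = 0 := by rw [tsum_mul_left, hD0, mul_zero]
  have s4 : (fun n => mu * D n) = fun n => sm q L Y tau X n - c * sm q L Y (Function.update tau j t) X n := by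
    funext n; rw [hD n]; ring
  rw [s4, Summable.tsum_sub s1 (s2.mul_left c), tsum_mul_left] at s3
  exact sub_eq_zero.mp s3

def eps {P : ℕ} (j : Fin P) : ℤ := if (j : ℕ) = 0 then 1 else 0

lemma rot_val {P : ℕ} (i : Fin P) : ((finRotate P i : ℕ) : ℤ) = (i : ℕ) + 1 - eps (finRotate P i) * P := by
  cases P with
  | zero => exact i.elim0
  | succ p =>
    unfold eps
    by_cases h : i = Fin.last p
    · subst h
      simp
    · rw [coe_finRotate_of_ne_last h]
      simp

lemma pr_val {P : ℕ} (j : Fin P) : ((j : ℕ) : ℤ) = ((finRotate P).symm j : ℕ) + 1 - eps j * P := by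
  have := rot_val ((finRotate P).symm j)
  rwa [Equiv.apply_symm_apply] at this

noncomputable def frz (L : ℕ) {P : ℕ} (X : Fin P → ℤ) : Finset (Fin P) :=
  Finset.univ.filter fun j => X j = X ((finRotate P).symm j) + 1 - eps j * L

lemma exists_start {L P : ℕ} (hL : P < L) (X : Fin P → ℤ) (K : Finset (Fin P)) (hK : K ⊆ frz L X) (hne : K.Nonempty) :
    ∃ j ∈ K, (finRotate P).symm j ∉ K := by
  by_contra hcon
  push Not at hcon
  have himg : K.map (finRotate P).symm.toEmbedding = K := by
    apply Finset.eq_of_subset_of_card_le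
    · intro x hx
      rw [Finset.mem_map] at hx
      obtain ⟨j, hj, rfl⟩ := hx
      exact hcon j hj
    · simp
  have hs : ∀ F : Fin P → ℤ, ∑ j ∈ K, F ((finRotate P).symm j) = ∑ j ∈ K, F j := by
    intro F
    conv_rhs => rw [← himg]
    rw [Finset.sum_map]; rfl
  have h1 : ∑ j ∈ K, ((j : ℕ) : ℤ) = ∑ j ∈ K, (((finRotate P).symm j : ℕ) + 1 - eps j * P : ℤ) :=
    Finset.sum_congr rfl (fun j _ => pr_val j)
  have h2 : ∑ j ∈ K, X j = ∑ j ∈ K, (X ((finRotate P).symm j) + 1 - eps j * L) :=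
    Finset.sum_congr rfl (fun j hj => (Finset.mem_filter.mp (hK hj)).2)
  rw [Finset.sum_sub_distrib, Finset.sum_add_distrib, ← Finset.sum_mul] at h1 h2
  rw [hs X] at h2
  rw [hs (fun j => ((j:ℕ):ℤ))] at h1
  simp only [Finset.sum_const, nsmul_eq_mul, mul_one] at h1 h2
  have hc : 0 < (K.card : ℤ) := by exact_mod_cast hne.card_pos
  set E := ∑ i ∈ K, eps i
  have h3 : E * ((L:ℤ) - P) = 0 := by linarith
  rcases mul_eq_zero.mp h3 with h | h
  · rw [h] at h1; linarith
  · omega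

lemma QQ_frz {q : ℤ → ℤ → ℤ → ℂ} {mu c : ℂ} (hq : QProps q mu c) {L P : ℕ} (hP : 1 ≤ P) (hL : P < L) (Y X : Fin P → ℤ)
    (t : ℤ) (ht : -1 ≤ t) (K : Finset (Fin P)) (hK : K ⊆ frz L X) :
    QQ q L Y (fun _ => t + 1) X = c ^ K.card * QQ q L Y (fun i => if i ∈ K then t else t + 1) X := by
  induction K using Finset.strongInduction with
  | H K ih =>
    rcases K.eq_empty_or_nonempty with rfl | hne
    · simp
    · obtain ⟨j, hj, hp⟩ := exists_start hL X K hK hne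
      rw [ih (K.erase j) (Finset.erase_ssubset hj) ((Finset.erase_subset _ _).trans hK)]
      have hpj : (finRotate P).symm j ≠ j := fun h => hp (by rw [h]; exact hj)
      rw [row_replace hq hP hL Y (fun i => if i ∈ K.erase j then t else t + 1) X _ ((finRotate P).symm j) j hpj (eps j) t ht
        (if_neg (fun h => hp (Finset.mem_of_mem_erase h))) (if_neg (Finset.notMem_erase j K)) (pr_val j) (Finset.mem_filter.mp (hK hj)).2]
      · have : Function.update (fun i => if i ∈ K.erase j then t else t + 1) j t = fun i => if i ∈ K then t else t + 1 := by
          funext i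
          by_cases h : i = j
          · subst h; simp [hj]
          · simp [h]
        rw [this, ← mul_assoc, ← pow_succ, Finset.card_erase_add_one hj]
      · intro i
        split_ifs <;> omega

lemma QQ_ev {q : ℤ → ℤ → ℤ → ℂ} {mu c : ℂ} (hq : QProps q mu c) {L P : ℕ} (hP : 1 ≤ P) (hL : P < L) (Y X : Fin P → ℤ)
    (t : ℤ) (ht : 0 ≤ t) (K : Finset (Fin P)) :
    QQ q L Y (fun i => if i ∈ K then t else t + 1) X =
      ∑ M ∈ Kᶜ.powerset, mu ^ M.card * QQ q L Y (fun _ => t) (fun i => X i - if i ∈ M then 1 else 0) := by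
  have key : ∀ n, sm q L Y (fun i => if i ∈ K then t else t + 1) X n =
      ∑ M ∈ Kᶜ.powerset, mu ^ M.card * sm q L Y (fun _ => t) (fun i => X i - if i ∈ M then 1 else 0) n := by
    intro n
    have : ∀ σ, tm q L Y (fun i => if i ∈ K then t else t + 1) X n σ =
      ∑ M ∈ Kᶜ.powerset, mu ^ M.card * tm q L Y (fun _ => t) (fun i => X i - if i ∈ M then 1 else 0) n σ := by
      intro σ
      unfold tm
      set a : Fin P → ℤ := fun i => (((i : ℕ) : ℤ) - ((σ i : ℕ) : ℤ) + (P : ℤ) * n i - ∑ k, n k) with ha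
      rw [← Finset.prod_mul_prod_compl K]
      have e1 : ∏ i ∈ K, q (if i ∈ K then t else t + 1) (a i) (X i - Y (σ i) + n i * L) = ∏ i ∈ K, q t (a i) (X i - Y (σ i) + n i * L) :=
        Finset.prod_congr rfl (fun i hi => by rw [if_pos hi])
      have e2 : ∏ i ∈ Kᶜ, q (if i ∈ K then t else t + 1) (a i) (X i - Y (σ i) + n i * L) =
          ∏ i ∈ Kᶜ, (mu * q t (a i) (X i - Y (σ i) + n i * L - 1) + q t (a i) (X i - Y (σ i) + n i * L)) :=
        Finset.prod_congr rfl (fun i hi => by rw [if_neg (Finset.mem_compl.mp hi), hq.ev]; ring)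
      rw [e1, e2, Finset.prod_add, Finset.mul_sum, Finset.mul_sum]
      apply Finset.sum_congr rfl
      intro M hM
      rw [Finset.mem_powerset] at hM
      rw [Finset.prod_mul_distrib, Finset.prod_const, ← Finset.prod_mul_prod_compl K (fun i => q t (a i) (X i - (if i ∈ M then 1 else 0) - Y (σ i) + n i * L)),
        ← Finset.prod_sdiff hM]
      have f1 : ∏ i ∈ K, q t (a i) (X i - (if i ∈ M then 1 else 0) - Y (σ i) + n i * L) = ∏ i ∈ K, q t (a i) (X i - Y (σ i) + n i * L) := by
        apply Finset.prod_congr rfl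
        intro i hi
        rw [if_neg (fun h => Finset.mem_compl.mp (hM h) hi), sub_zero]
      have f2 : ∏ i ∈ Kᶜ \ M, q t (a i) (X i - (if i ∈ M then 1 else 0) - Y (σ i) + n i * L) = ∏ i ∈ Kᶜ \ M, q t (a i) (X i - Y (σ i) + n i * L) := by
        apply Finset.prod_congr rfl
        intro i hi
        rw [if_neg (Finset.mem_sdiff.mp hi).2, sub_zero]
      have f3 : ∏ i ∈ M, q t (a i) (X i - (if i ∈ M then 1 else 0) - Y (σ i) + n i * L) = ∏ i ∈ M, q t (a i) (X i - Y (σ i) + n i * L - 1) := by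
        apply Finset.prod_congr rfl
        intro i hi
        rw [if_pos hi]; congr 1; ring
      rw [f1, f2, f3]
      ring
    unfold sm
    rw [Finset.sum_congr rfl (fun σ _ => this σ), Finset.sum_comm, Finset.mul_sum]
    apply Finset.sum_congr rfl
    intro M _
    rw [← Finset.mul_sum]; ring
  unfold QQ
  rw [tsum_congr key, Summable.tsum_finsetSum]
  · apply Finset.sum_congr rfl
    intro M _
    rw [tsum_mul_left]
  · intro M _
    apply Summable.mul_left
    exact summable_of_hasFiniteSupport (tm_fin hq hP hL Y _ _ (fun _ => by omega) ⟨⟨0, hP⟩, ht⟩)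

lemma sign_rot {P : ℕ} (hP : 1 ≤ P) : ((Equiv.Perm.sign (finRotate P) : ℤ) : ℂ) = (-1 : ℂ) ^ ((P : ℤ) - 1) := by
  obtain ⟨p, rfl⟩ : ∃ p, P = p + 1 := ⟨P - 1, by omega⟩
  rw [sign_finRotate]
  push_cast
  rw [add_sub_cancel_right, zpow_natCast]

lemma sum_eps {P : ℕ} (hP : 1 ≤ P) : ∑ i : Fin P, eps i = 1 := by
  obtain ⟨p, rfl⟩ : ∃ p, P = p + 1 := ⟨P - 1, by omega⟩
  unfold eps
  rw [Fin.sum_univ_succ]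
  simp

lemma QQ_rot (q : ℤ → ℤ → ℤ → ℂ) {L P : ℕ} (hP : 1 ≤ P) (Y X : Fin P → ℤ) (t : ℤ) :
    QQ q L Y (fun _ => t) (fun i => X (finRotate P i) + eps (finRotate P i) * L) = QQ q L Y (fun _ => t) X := by
  let ρ := finRotate P
  let e : (Fin P → ℤ) ≃ (Fin P → ℤ) := (Equiv.arrowCongr ρ (Equiv.refl ℤ)).trans (Equiv.addRight eps)
  have he : ∀ n i, e n (ρ i) = n i + eps (ρ i) := by intro n i; simp [e]
  have hes : ∀ n, ∑ i, e n i = ∑ i, n i + 1 := by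
    intro n
    rw [← Equiv.sum_comp ρ, Finset.sum_congr rfl (fun i _ => he n i), Finset.sum_add_distrib, Equiv.sum_comp ρ eps, sum_eps hP]
  unfold QQ
  rw [← Equiv.tsum_eq e (fun n => sm q L Y (fun _ => t) X n)]
  apply tsum_congr
  intro n
  unfold sm
  rw [hes, mul_add, mul_one, zpow_add₀ (by norm_num), mul_assoc]
  congr 1
  rw [Finset.mul_sum]
  apply Fintype.sum_equiv (Equiv.mulRight ρ⁻¹)
  intro σ
  unfold tm
  rw [Equiv.coe_mulRight, hes]
  have hsg : ((Equiv.Perm.sign (σ * ρ⁻¹) : ℤ) : ℂ) = (-1) ^ ((P:ℤ) - 1) * ((Equiv.Perm.sign σ : ℤ) : ℂ) := by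
    rw [Equiv.Perm.sign_mul, Equiv.Perm.sign_inv, ← sign_rot hP]
    push_cast; ring
  rw [hsg, ← mul_assoc, ← mul_assoc, ← mul_zpow]
  rw [show (-1 : ℂ) * -1 = 1 by norm_num, one_zpow, one_mul]
  congr 1
  apply Fintype.prod_equiv ρ
  intro i
  rw [he]
  have : (σ * ρ⁻¹) (ρ i) = σ i := by simp
  have h2 := rot_val i
  congr 1
  · show _ = ((finRotate P i : ℕ) : ℤ) - _ + _ - _
    rw [h2, this]
    show _ = _ + _ * (_ + eps (finRotate P i)) - _
    ring
  · rw [this]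
    show _ = X (finRotate P i) - _ + (_ + eps (finRotate P i)) * _
    ring

lemma hermite {P : ℕ} (hP : 1 ≤ P) (d : ℤ) : ∑ i : Fin P, (((i : ℕ) : ℤ) + d) / P = d := by
  have hP' : (P : ℤ) ≠ 0 := by omega
  have step : ∀ d : ℤ, ∑ i : Fin P, (((i : ℕ) : ℤ) + (d + 1)) / P = ∑ i : Fin P, (((i : ℕ) : ℤ) + d) / P + 1 := by
    intro d
    have h1 := Finset.sum_range_succ (fun i : ℕ => ((i:ℤ) + d) / P) P
    have h2 := Finset.sum_range_succ' (fun i : ℕ => ((i:ℤ) + d) / P) P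
    rw [Fin.sum_univ_eq_sum_range (fun i : ℕ => ((i:ℤ) + (d + 1)) / P), Fin.sum_univ_eq_sum_range (fun i : ℕ => ((i:ℤ) + d) / P)]
    have h3 : ((P:ℤ) + d) / P = d / P + 1 := by
      rw [add_comm, Int.add_ediv_of_dvd_right (dvd_refl _), Int.ediv_self hP']
    have h4 : ∑ i ∈ Finset.range P, ((i:ℤ) + (d + 1)) / P = ∑ i ∈ Finset.range P, (((i + 1 : ℕ):ℤ) + d) / P := by
      apply Finset.sum_congr rfl
      intro i _
      congr 1; push_cast; ring
    rw [h4]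
    simp only [Nat.cast_zero, zero_add] at h2
    linarith
  have base : ∑ i : Fin P, (((i : ℕ) : ℤ) + 0) / P = 0 := by
    apply Finset.sum_eq_zero
    intro i _
    rw [add_zero]
    exact Int.ediv_eq_zero_of_lt (by omega) (by have := i.2; omega)
  induction d using Int.induction_on with
  | zero => exact base
  | succ i ih => rw [step, ih]
  | pred i ih =>
    have := step (-(i:ℤ) - 1)
    rw [sub_add_cancel, ih] at this
    linarith

def ext {P : ℕ} (hP : 1 ≤ P) (L : ℤ) (X : Fin P → ℤ) (m : ℤ) : ℤ :=
  X ⟨(m % P).toNat, by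
    have := Int.emod_lt_of_pos m (show (0:ℤ) < P by omega)
    have := Int.emod_nonneg m (show (P:ℤ) ≠ 0 by omega)
    omega⟩ + L * (m / P)

lemma ext_apply {P : ℕ} (hP : 1 ≤ P) (L : ℤ) (X : Fin P → ℤ) (i : Fin P) (k : ℤ) :
    ext hP L X ((i : ℕ) + P * k) = X i + L * k := by
  have hi := i.2
  have h1 : (((i : ℕ) : ℤ) + P * k) % P = (i : ℕ) := by
    rw [Int.add_mul_emod_self_left]
    exact Int.emod_eq_of_lt (by omega) (by omega)
  have h2 : (((i : ℕ) : ℤ) + P * k) / P = k := by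
    rw [Int.add_mul_ediv_left _ _ (by omega), Int.ediv_eq_zero_of_lt (by omega) (by omega), zero_add]
  unfold ext
  rw [h2]
  congr 2
  apply Fin.ext
  simp [h1]

lemma ext_rep {P : ℕ} (hP : 1 ≤ P) (m : ℤ) : ∃ (i : Fin P) (k : ℤ), m = (i : ℕ) + P * k := by
  have := Int.emod_lt_of_pos m (show (0:ℤ) < P by omega)
  have := Int.emod_nonneg m (show (P:ℤ) ≠ 0 by omega)
  refine ⟨⟨(m % P).toNat, by omega⟩, m / P, ?_⟩
  simp only
  rw [Int.toNat_of_nonneg (by omega)]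
  exact (Int.emod_add_mul_ediv m P).symm

lemma ext_per {P : ℕ} (hP : 1 ≤ P) (L : ℤ) (X : Fin P → ℤ) (m k : ℤ) :
    ext hP L X (m + P * k) = ext hP L X m + L * k := by
  obtain ⟨i, l, rfl⟩ := ext_rep hP m
  rw [ext_apply, show ((i:ℕ):ℤ) + P * l + P * k = (i:ℕ) + P * (l + k) by ring, ext_apply]; ring

lemma cross {P : ℕ} (hP : 1 ≤ P) (n : Fin P → ℤ) (σ : Equiv.Perm (Fin P)) (w : Fin P → ℤ)
    (hw : ∀ i, w i = (σ i : ℕ) - P * n i + ∑ k, n k) (c : ℤ) :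
    ((∀ m < c, ext hP P w m < c) → ∀ m, c ≤ m → c ≤ ext hP P w m) ∧
    ((∀ m, c ≤ m → c ≤ ext hP P w m) → ∀ m < c, ext hP P w m < c) := by
  have hPp : (0:ℤ) < P := by omega
  have hsum : ∑ i, (w i - c) / P = ∑ i : Fin P, (((i : ℕ) : ℤ) - c) / P := by
    have h1 : ∀ i, (w i - c) / P = (((σ i : ℕ) : ℤ) + (∑ k, n k - c)) / P - n i := by
      intro i
      rw [hw, show ((σ i : ℕ) : ℤ) - P * n i + ∑ k, n k - c = ((σ i : ℕ) : ℤ) + (∑ k, n k - c) + P * (- n i) by ring,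
        Int.add_mul_ediv_left _ _ (by omega)]
      ring
    rw [Finset.sum_congr rfl (fun i _ => h1 i), Finset.sum_sub_distrib,
      Equiv.sum_comp σ (fun i : Fin P => (((i : ℕ) : ℤ) + (∑ k, n k - c)) / P), hermite hP]
    have := hermite hP (-c)
    simp only [← sub_eq_add_neg] at this
    rw [this]; ring
  constructor
  · intro h
    have hle : ∀ i ∈ (Finset.univ : Finset (Fin P)), (w i - c) / P ≤ (((i : ℕ) : ℤ) - c) / P := by
      intro i _
      rw [← Int.lt_add_one_iff, Int.ediv_lt_iff_lt_mul hPp]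
      have h1 := h ((i:ℕ) + P * (-((((i : ℕ) : ℤ) - c) / P + 1))) (by
        have := Int.lt_ediv_add_one_mul_self (((i : ℕ) : ℤ) - c) hPp
        linarith)
      rw [ext_apply] at h1
      linarith
    have heq := (Finset.sum_eq_sum_iff_of_le hle).mp hsum
    intro m hm
    obtain ⟨i, k, rfl⟩ := ext_rep hP m
    rw [ext_apply]
    have h1 : -k ≤ (((i : ℕ) : ℤ) - c) / P := by
      rw [Int.le_ediv_iff_mul_le hPp]; linarith
    rw [← heq i (Finset.mem_univ _), Int.le_ediv_iff_mul_le hPp] at h1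
    linarith
  · intro h
    have hle : ∀ i ∈ (Finset.univ : Finset (Fin P)), (((i : ℕ) : ℤ) - c) / P ≤ (w i - c) / P := by
      intro i _
      rw [Int.le_ediv_iff_mul_le hPp]
      have h1 := h ((i:ℕ) + P * (-((((i : ℕ) : ℤ) - c) / P))) (by
        have := Int.ediv_mul_le (((i : ℕ) : ℤ) - c) hPp.ne'
        linarith)
      rw [ext_apply] at h1
      linarith
    have heq := (Finset.sum_eq_sum_iff_of_le hle).mp hsum.symm
    intro m hm
    obtain ⟨i, k, rfl⟩ := ext_rep hP m
    rw [ext_apply]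
    have h1 : (((i : ℕ) : ℤ) - c) / P < -k := by
      rw [Int.ediv_lt_iff_lt_mul hPp]; linarith
    rw [heq i (Finset.mem_univ _), Int.ediv_lt_iff_lt_mul hPp] at h1
    linarith

lemma analysis (g h ω : ℤ → ℤ) (Fz : ℤ → Prop) (hg : Monotone g) (hh : Monotone h)
    (hF : ∀ m, Fz m ↔ g (m-1) = g m) (hun : ∀ m, ∃ k : ℕ, g (m - k) ≠ g m)
    (c1 : ∀ c, (∀ m < c, ω m < c) → ∀ m, c ≤ m → c ≤ ω m)
    (c2 : ∀ c, (∀ m, c ≤ m → c ≤ ω m) → ∀ m < c, ω m < c)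
    (h1 : ∀ m, m ≤ ω m → h (ω m) ≤ g m)
    (h2 : ∀ m, ω m < m → g m ≤ h (ω m))
    (h3 : ∀ m, ¬ Fz m → ω m = m → g m ≤ h m)
    (h4 : ∀ m, Fz m → ω m < m → g m < h (ω m)) :
    (∀ m, g m = h m) ∧ ∀ m, m ≤ ω m := by
  have start : ∀ m, ∃ m0 ≤ m, ¬ Fz m0 ∧ g m0 = g m := by
    intro m
    by_contra hcon
    push Not at hcon
    have : ∀ k : ℕ, g (m - k) = g m := by
      intro k
      induction k with
      | zero => simp
      | succ k ih =>
        have hf : Fz (m - k) := by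
          by_contra hf
          exact hcon (m - k) (by omega) hf ih
        rw [hF] at hf
        rw [← ih, ← hf]; congr 1; push_cast; ring
    obtain ⟨k, hk⟩ := hun m
    exact hk (this k)
  have A1 : ∀ i, h i ≤ g i := by
    intro i
    by_contra hlt
    push Not at hlt
    have hc : ∀ m < i, ω m < i := by
      intro m hm
      by_contra hq
      push Not at hq
      have := h1 m (by omega)
      have := hh hq
      have := hg hm.le
      omega
    have hi := c1 i hc i le_rfl
    have := h1 i hi
    have := hh hi
    omega
  have A2 : ∀ i, ¬ Fz i → g i ≤ h i := by
    intro i hf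
    by_contra hlt
    push Not at hlt
    have hc : ∀ m, i + 1 ≤ m → i + 1 ≤ ω m := by
      intro m hm
      by_contra hq
      push Not at hq
      have := h2 m (by omega)
      have := hh (show ω m ≤ i by omega)
      have := hg (show i ≤ m by omega)
      omega
    have hi := c2 (i+1) hc i (by omega)
    rcases lt_trichotomy (ω i) i with h | h | h
    · have := h2 i h
      have := hh h.le
      omega
    · have := h3 i hf h
      omega
    · omega
  have A3 : ∀ i, g i = h i := by
    intro i
    apply le_antisymm _ (A1 i)
    obtain ⟨m, hm, hf, he⟩ := start i
    rw [← he]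
    exact (A2 m hf).trans (hh hm)
  refine ⟨A3, ?_⟩
  intro m
  by_contra hlt
  push Not at hlt
  by_cases hf : Fz m
  · have := h4 m hf hlt
    rw [← A3] at this
    have := hg hlt.le
    omega
  · have := h2 m hlt
    rw [← A3] at this
    have := hg (show ω m ≤ m - 1 by omega)
    have := hg (show m - 1 ≤ m by omega)
    exact hf ((hF m).mpr (by omega))

lemma ext_mono {L P : ℕ} (hP : 1 ≤ P) (X : Fin P → ℤ) (hX : IsConfig L P X) :
    Monotone (fun m => ext hP L X m - m) := by
  apply monotone_int_of_le_succ
  intro m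
  obtain ⟨i, k, rfl⟩ := ext_rep hP m
  by_cases hi : (i : ℕ) + 1 < P
  · have e : ((i:ℕ):ℤ) + P * k + 1 = ((⟨i + 1, hi⟩ : Fin P) : ℕ) + P * k := by push_cast; ring
    rw [ext_apply, e, ext_apply]
    have : X i < X ⟨i + 1, hi⟩ := hX.1 (by simp [Fin.lt_def])
    push_cast; omega
  · have e : ((i:ℕ):ℤ) + P * k + 1 = ((⟨0, hP⟩ : Fin P) : ℕ) + P * (k + 1) := by
      have : (P:ℤ) = i + 1 := by have := i.2; omega
      push_cast; rw [mul_add]; linarith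
    rw [ext_apply, e, ext_apply, ← e]
    have := (hX.2 i).2
    have := (hX.2 ⟨0, hP⟩).1
    rw [mul_add]
    omega

lemma tm_init {q : ℤ → ℤ → ℤ → ℂ} {mu c : ℂ} (hq : QProps q mu c) {L P : ℕ} (hP : 1 ≤ P) (hL : P < L) (Y X n : Fin P → ℤ)
    (hX : IsConfig L P X) (hY : IsConfig L P Y) (σ : Equiv.Perm (Fin P))
    (h : tm q L Y (fun i => if i ∈ frz L X then -1 else 0) X n σ ≠ 0) : σ = 1 ∧ n = 0 ∧ X = Y := by
  have hPp : (0:ℤ) < P := by omega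
  set S := ∑ k, n k with hS
  let w : Fin P → ℤ := fun i => (σ i : ℕ) - P * n i + S
  let g : ℤ → ℤ := fun m => ext hP L X m - m
  let hh : ℤ → ℤ := fun m => ext hP L Y (m - S) - m
  let ω := ext hP P w
  let Fz : ℤ → Prop := fun m => g (m - 1) = g m
  have hgm : Monotone g := ext_mono hP X hX
  have hhm : Monotone hh := by
    intro a b hab
    have := ext_mono hP Y hY (show a - S ≤ b - S by omega)
    simp only [hh] at *
    omega
  have hFz : ∀ (i : Fin P) (k : ℤ), Fz ((i:ℕ) + P * k) ↔ i ∈ frz L X := by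
    intro i k
    simp only [Fz, g, frz, Finset.mem_filter, Finset.mem_univ, true_and]
    have hp := pr_val i
    have e : ((i:ℕ):ℤ) + P * k - 1 = ((finRotate P).symm i : ℕ) + P * (k - eps i) := by rw [hp]; ring
    rw [ext_apply, e, ext_apply, ← e]
    constructor <;> intro h <;> linarith
  have cond : ∀ m, (m ≤ ω m → hh (ω m) ≤ g m) ∧ (ω m < m → g m ≤ hh (ω m)) ∧ (¬ Fz m → ω m = m → g m ≤ hh m) ∧
      (Fz m → ω m < m → g m < hh (ω m)) := by
    intro m
    obtain ⟨i, k, rfl⟩ := ext_rep hP m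
    have h0 := tm_zero hq Y _ X n σ h i
    have hω : ω ((i:ℕ) + P * k) = w i + P * k := ext_apply hP _ _ _ _
    have hgi : g ((i:ℕ) + P * k) = X i + L * k - ((i:ℕ) + P * k) := by simp only [g, ext_apply]
    have hhi : hh (w i + P * k) = Y (σ i) + L * (k - n i) - (w i + P * k) := by
      simp only [hh]
      rw [show w i + P * k - S = ((σ i : ℕ):ℤ) + P * (k - n i) by simp only [w]; ring, ext_apply]
    rw [hFz, hω, hhi, hgi]
    rw [← hS] at h0
    have ea : ((i:ℕ):ℤ) - ((σ i : ℕ):ℤ) + P * n i - S = (i:ℕ) - w i := by simp only [w]; ring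
    rw [ea] at h0
    obtain ⟨ha, hb⟩ := h0
    refine ⟨?_, ?_, ?_, ?_⟩
    · intro h
      have := ha (by linarith)
      linarith
    · intro h
      have : 0 ≤ (if i ∈ frz L X then (-1:ℤ) else 0) + ((i:ℕ) - w i) := by split_ifs <;> omega
      have h5 := hb this
      have : (if i ∈ frz L X then (-1:ℤ) else 0) ≤ 0 := by split_ifs <;> omega
      linarith
    · intro hf h
      rw [if_neg hf] at hb
      have := hb (by linarith)
      rw [← h, hhi]
      linarith
    · intro hf h
      rw [if_pos hf] at hb
      have := hb (by omega)
      linarith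
  obtain ⟨hgh, hle⟩ := analysis g hh ω Fz hgm hhm (fun _ => Iff.rfl)
    (by
      intro m
      refine ⟨P, ?_⟩
      have := ext_per hP L X m (-1)
      simp only [g]
      rw [show m - (P:ℤ) = m + P * (-1) by ring, this]
      intro h; apply hL.ne; have : (P:ℤ) = L := by linarith
      exact_mod_cast this)
    (fun c => (cross hP n σ w (fun _ => rfl) c).1) (fun c => (cross hP n σ w (fun _ => rfl) c).2)
    (fun m => (cond m).1) (fun m => (cond m).2.1) (fun m => (cond m).2.2.1) (fun m => (cond m).2.2.2)
  have hw : ∀ i : Fin P, ((i:ℕ):ℤ) ≤ w i := by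
    intro i
    have := hle ((i:ℕ) + P * 0)
    simp only [ω] at this
    rw [ext_apply] at this
    linarith
  have hw2 : ∀ i : Fin P, ((i:ℕ):ℤ) = w i := by
    have hs := sum_lvl n σ
    have : ∑ i : Fin P, ((i:ℕ):ℤ) = ∑ i, w i := by
      rw [← sub_eq_zero, ← Finset.sum_sub_distrib, ← hs]
      apply Finset.sum_congr rfl
      intro i _
      simp only [w, hS]; ring
    have := (Finset.sum_eq_sum_iff_of_le (fun i _ => hw i)).mp this
    exact fun i => this i (Finset.mem_univ _)
  have hxy : ∀ m, ext hP L X m = ext hP L Y (m - S) := by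
    intro m
    have := hgh m
    simp only [g, hh] at this
    linarith
  have hS0 : S = 0 := by
    have hLp : (0:ℤ) < L := by omega
    obtain ⟨j, k, hjk⟩ := ext_rep hP (-S)
    have h1 := hxy (((⟨0, hP⟩ : Fin P) : ℕ) + P * 0)
    rw [ext_apply, show ((((⟨0, hP⟩ : Fin P) : ℕ):ℤ) + P * 0 - S) = -S by push_cast; ring, hjk, ext_apply] at h1
    have b1 := hX.2 ⟨0, hP⟩
    have b2 := hY.2 j
    have k1 : 0 ≤ k := by
      by_contra hk
      have : (L:ℤ) * k ≤ L * (-1) := mul_le_mul_of_nonneg_left (by omega) hLp.le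
      omega
    obtain ⟨j', k', hjk'⟩ := ext_rep hP (P - 1 - S)
    have h2 := hxy (((⟨P-1, by omega⟩ : Fin P) : ℕ) + P * 0)
    rw [ext_apply, show ((((⟨P-1, by omega⟩ : Fin P) : ℕ):ℤ) + P * 0 - S) = P - 1 -S by
      push_cast [Nat.cast_sub hP]; ring, hjk', ext_apply] at h2
    have b1' := hX.2 ⟨P-1, by omega⟩
    have b2' := hY.2 j'
    have k2 : k' ≤ 0 := by
      by_contra hk
      have : (L:ℤ) * 1 ≤ L * k' := mul_le_mul_of_nonneg_left (by omega) hLp.le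
      omega
    have : 0 ≤ (P:ℤ) * k := mul_nonneg hPp.le k1
    have : (P:ℤ) * k' ≤ 0 := mul_nonpos_of_nonneg_of_nonpos hPp.le k2
    have := j'.2
    omega
  have hn : ∀ i, n i = 0 := by
    intro i
    have := hw2 i
    simp only [w, hS0] at this
    have b1 := i.2
    have b2 := (σ i).2
    by_contra hne
    rcases lt_or_gt_of_ne hne with h | h
    · have : (P:ℤ) * n i ≤ P * (-1) := mul_le_mul_of_nonneg_left (by omega) hPp.le
      omega
    · have : (P:ℤ) * 1 ≤ P * n i := mul_le_mul_of_nonneg_left (by omega) hPp.le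
      omega
  refine ⟨?_, funext hn, ?_⟩
  · ext i
    have := hw2 i
    simp only [w, hS0, hn i] at this
    simp only [Equiv.Perm.one_apply]
    omega
  · funext i
    have := hxy ((i:ℕ) + P * 0)
    rw [hS0, sub_zero, ext_apply, ext_apply] at this
    linarith

lemma QQ_init {q : ℤ → ℤ → ℤ → ℂ} {mu c : ℂ} (hq : QProps q mu c) {L P : ℕ} (hP : 1 ≤ P) (hL : P < L) (Y X : Fin P → ℤ)
    (hX : IsConfig L P X) (hY : IsConfig L P Y) :
    QQ q L Y (fun i => if i ∈ frz L X then -1 else 0) X = if X = Y then 1 else 0 := by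
  unfold QQ
  rw [tsum_eq_single 0]
  · unfold sm
    rw [Finset.sum_eq_single (1 : Equiv.Perm (Fin P))]
    · split_ifs with h
      · subst h
        unfold tm
        simp only [Equiv.Perm.sign_one, Equiv.Perm.one_apply, Pi.zero_apply, Finset.sum_const_zero]
        have : ∀ i, q (if i ∈ frz L X then -1 else 0) (((i:ℕ):ℤ) - (i:ℕ) + P * 0 - 0) (X i - X i + 0 * L) = 1 := by
          intro i
          simp only [sub_self, mul_zero, zero_mul, add_zero]
          split_ifs
          · exact hq.z1
          · exact hq.z0
        rw [Finset.prod_congr rfl (fun i _ => this i)]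
        simp
      · rw [mul_eq_zero]; right
        by_contra hne
        exact h (tm_init hq hP hL Y X 0 hX hY 1 hne).2.2
    · intro σ _ hσ
      by_contra hne
      exact hσ (tm_init hq hP hL Y X 0 hX hY σ hne).1
    · simp
  · intro n hn
    unfold sm
    rw [mul_eq_zero]; right
    apply Finset.sum_eq_zero
    intro σ _
    by_contra hne
    exact hn (tm_init hq hP hL Y X n hX hY σ hne).2.1

lemma eps_cases {P : ℕ} (j : Fin P) : ((j : ℕ) = 0 ∧ eps j = 1) ∨ ((j : ℕ) ≠ 0 ∧ eps j = 0) := by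
  unfold eps
  by_cases h : (j : ℕ) = 0 <;> simp [h]

def cyc (L : ℕ) {P : ℕ} (X : Fin P → ℤ) : Prop :=
  ∀ j, X ((finRotate P).symm j) + 1 - eps j * L ≤ X j

noncomputable def ind {P : ℕ} (M : Finset (Fin P)) (i : Fin P) : ℤ := if i ∈ M then 1 else 0

lemma ind_cases {P : ℕ} (M : Finset (Fin P)) (j : Fin P) :
    (j ∈ M ∧ ind M j = 1) ∨ (j ∉ M ∧ ind M j = 0) := by
  unfold ind
  by_cases h : j ∈ M <;> simp [h]

lemma cyc_step {L P : ℕ} {X : Fin P → ℤ} (h : cyc L X) : StrictMono X := by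
  have key : ∀ d : ℕ, ∀ i j : Fin P, (j : ℕ) = i + d + 1 → X i < X j := by
    intro d
    induction d with
    | zero =>
      intro i j hij
      have h1 := h j
      have h2 := pr_val j
      rcases eps_cases j with ⟨h3, h4⟩ | ⟨h3, h4⟩
      · omega
      · rw [h4] at h1 h2
        have : (finRotate P).symm j = i := by
          apply Fin.ext; omega
        rw [this] at h1
        omega
    | succ d ih =>
      intro i j hij
      have h1 := h j
      have h2 := pr_val j
      rcases eps_cases j with ⟨h3, h4⟩ | ⟨h3, h4⟩
      · omega
      · rw [h4] at h1 h2
        have := ih i ((finRotate P).symm j) (by omega)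
        omega
  intro i j hij
  exact key ((j : ℕ) - i - 1) i j (by have : (i : ℕ) < j := hij; omega)

lemma config_cyc {L P : ℕ} {X : Fin P → ℤ} (hX : IsConfig L P X) : cyc L X := by
  intro j
  have h2 := pr_val j
  rcases eps_cases j with ⟨h3, h4⟩ | ⟨h3, h4⟩
  · rw [h4]
    have := (hX.2 j).1
    have := (hX.2 ((finRotate P).symm j)).2
    omega
  · rw [h4] at h2 ⊢
    have : X ((finRotate P).symm j) < X j := hX.1 (by
      show ((finRotate P).symm j : ℕ) < (j : ℕ)
      omega)
    omega

lemma succ_iff {L P : ℕ} (_hL : P < L) {X : Fin P → ℤ} (hX : IsConfig L P X) (i j : Fin P) :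
    X j = succSite L (X i) ↔ j = finRotate P i ∧ X j = X i + 1 - eps j * L := by
  have hr := rot_val i
  have hi := i.2
  have hj := j.2
  have hi1 := hX.2 i
  have hj1 := hX.2 j
  have hmono : ∀ a b : Fin P, (a : ℕ) < b → X a < X b := fun a b h => hX.1 h
  unfold succSite
  constructor
  · intro h
    by_cases hl : X i = L
    · rw [if_pos hl] at h
      have hj0 : (j : ℕ) = 0 := by
        by_contra hne
        have := hmono ⟨0, by omega⟩ j (by show 0 < (j : ℕ); omega)
        have := (hX.2 ⟨0, by omega⟩).1
        omega
      have hil : (i : ℕ) + 1 = P := by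
        by_contra hne
        have := hmono i ⟨P - 1, by omega⟩ (by show (i : ℕ) < P - 1; omega)
        have := (hX.2 ⟨P - 1, by omega⟩).2
        omega
      have e : j = finRotate P i := by
        apply Fin.ext
        rcases eps_cases (finRotate P i) with ⟨h3, h4⟩ | ⟨h3, h4⟩
        · omega
        · rw [h4] at hr
          have := (finRotate P i).2
          omega
      refine ⟨e, ?_⟩
      rcases eps_cases j with ⟨h3, h4⟩ | ⟨h3, h4⟩
      · rw [h4]; omega
      · omega
    · rw [if_neg hl] at h
      have hlt : (i : ℕ) < j := by
        by_contra hge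
        rcases Nat.lt_or_ge (j : ℕ) i with h1 | h1
        · have := hmono j i h1; omega
        · have : i = j := Fin.ext (by omega)
          subst this; omega
      have hij : (j : ℕ) = i + 1 := by
        by_contra hne
        have := hmono i ⟨i + 1, by omega⟩ (by show (i : ℕ) < i + 1; omega)
        have := hmono ⟨i + 1, by omega⟩ j (by show (i : ℕ) + 1 < j; omega)
        omega
      have e : j = finRotate P i := by
        apply Fin.ext
        rcases eps_cases (finRotate P i) with ⟨h3, h4⟩ | ⟨h3, h4⟩
        · rw [h4] at hr; omega
        · rw [h4] at hr; omega
      refine ⟨e, ?_⟩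
      rcases eps_cases j with ⟨h3, h4⟩ | ⟨h3, h4⟩
      · omega
      · rw [h4]; omega
  · rintro ⟨-, h⟩
    rcases eps_cases j with ⟨h3, h4⟩ | ⟨h3, h4⟩
    · rw [h4] at h
      rw [if_pos (by omega)]; omega
    · rw [h4] at h
      rw [if_neg (by omega)]; omega

lemma mem_frz {L P : ℕ} (X : Fin P → ℤ) (j : Fin P) :
    j ∈ frz L X ↔ X j = X ((finRotate P).symm j) + 1 - eps j * L := by
  unfold frz
  rw [Finset.mem_filter]
  exact ⟨fun h => h.2, fun h => ⟨Finset.mem_univ _, h⟩⟩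

lemma free_iff {L P : ℕ} (hL : P < L) {X : Fin P → ℤ} (hX : IsConfig L P X) (i : Fin P) :
    (∀ j, X j ≠ succSite L (X i)) ↔ finRotate P i ∉ frz L X := by
  rw [mem_frz, Equiv.symm_apply_apply]
  constructor
  · intro h h2
    exact h _ ((succ_iff hL hX i (finRotate P i)).2 ⟨rfl, h2⟩)
  · intro h j h2
    obtain ⟨rfl, h3⟩ := (succ_iff hL hX i j).1 h2
    exact h h3

lemma frz_card {L P : ℕ} (hL : P < L) {X : Fin P → ℤ} (hX : IsConfig L P X) :
    Nc L X + (frz L X).card = P := by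
  have h1 : Nc L X = (frz L X)ᶜ.card := by
    unfold Nc
    apply Finset.card_bij (fun i _ => finRotate P i)
    · intro i hi
      rw [Finset.mem_filter] at hi
      rw [Finset.mem_compl]
      exact (free_iff hL hX i).1 hi.2
    · intro a _ b _ h
      exact (finRotate P).injective h
    · intro j hj
      rw [Finset.mem_compl] at hj
      refine ⟨(finRotate P).symm j, ?_, Equiv.apply_symm_apply _ _⟩
      rw [Finset.mem_filter]
      refine ⟨Finset.mem_univ _, (free_iff hL hX _).2 ?_⟩
      rwa [Equiv.apply_symm_apply]
  rw [h1, Finset.card_compl, Fintype.card_fin]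
  have := Finset.card_le_univ (frz L X)
  rw [Fintype.card_fin] at this
  omega

/-- gap condition before the move -/
def GG (L : ℕ) {P : ℕ} (Z : Fin P → ℤ) (M : Finset (Fin P)) : Prop :=
  ∀ j, Z ((finRotate P).symm j) + ind M ((finRotate P).symm j) + 1 - eps j * L ≤ Z j

/-- gap condition after the move -/
def HH (L : ℕ) {P : ℕ} (X : Fin P → ℤ) (M : Finset (Fin P)) : Prop :=
  ∀ j, X ((finRotate P).symm j) + ind M j + 1 - eps j * L ≤ X j

lemma GG_iff {L P : ℕ} (hL : P < L) {Z : Fin P → ℤ} (hZ : IsConfig L P Z) (M : Finset (Fin P)) :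
    (∀ i ∈ M, ∀ j, Z j ≠ succSite L (Z i)) ↔ GG L Z M := by
  constructor
  · intro h j
    have hc := config_cyc hZ j
    rcases ind_cases M ((finRotate P).symm j) with ⟨h1, h2⟩ | ⟨h1, h2⟩
    · rw [h2]
      have := (free_iff hL hZ _).1 (h _ h1)
      rw [mem_frz, Equiv.apply_symm_apply] at this
      omega
    · rw [h2]; omega
  · intro h i hi
    rw [free_iff hL hZ, mem_frz]
    have := h (finRotate P i)
    rw [Equiv.symm_apply_apply] at this ⊢
    rcases ind_cases M i with ⟨h1, h2⟩ | ⟨h1, h2⟩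
    · rw [h2] at this; omega
    · exact absurd hi h1

lemma HH_iff {L P : ℕ} {X : Fin P → ℤ} (hX : cyc L X) (M : Finset (Fin P)) :
    M ⊆ (frz L X)ᶜ ↔ HH L X M := by
  constructor
  · intro h j
    have hc := hX j
    rcases ind_cases M j with ⟨h1, h2⟩ | ⟨h1, h2⟩
    · have := h h1
      rw [Finset.mem_compl, mem_frz] at this
      omega
    · omega
  · intro h j hj
    rw [Finset.mem_compl, mem_frz]
    have := h j
    rcases ind_cases M j with ⟨h1, h2⟩ | ⟨h1, h2⟩
    · omega
    · exact absurd hj h1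

lemma HH_of_GG {L P : ℕ} {Z : Fin P → ℤ} {M : Finset (Fin P)} (h : GG L Z M) :
    HH L (fun i => Z i + ind M i) M := by
  intro j
  have := h j
  show Z _ + ind M _ + ind M j + 1 - eps j * L ≤ Z j + ind M j
  omega

lemma GG_of_HH {L P : ℕ} {X : Fin P → ℤ} {M : Finset (Fin P)} (h : HH L X M) :
    GG L (fun i => X i - ind M i) M := by
  intro j
  have := h j
  show X _ - ind M _ + ind M _ + 1 - eps j * L ≤ X j - ind M j
  omega

lemma cyc_of_HH {L P : ℕ} {X : Fin P → ℤ} {M : Finset (Fin P)} (h : HH L X M) : cyc L X := by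
  intro j
  have := h j
  rcases ind_cases M j with ⟨h1, h2⟩ | ⟨h1, h2⟩ <;> omega

lemma cyc_of_GG {L P : ℕ} {X : Fin P → ℤ} {M : Finset (Fin P)} (h : GG L X M) : cyc L X := by
  intro j
  have := h j
  rcases ind_cases M ((finRotate P).symm j) with ⟨h1, h2⟩ | ⟨h1, h2⟩ <;> omega

def RZ (L : ℕ) {P : ℕ} (Z : Fin P → ℤ) : Fin P → ℤ :=
  fun i => Z (finRotate P i) + eps (finRotate P i) * L

def RZi (L : ℕ) {P : ℕ} (Z : Fin P → ℤ) : Fin P → ℤ :=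
  fun j => Z ((finRotate P).symm j) - eps j * L

def RM {P : ℕ} (M : Finset (Fin P)) : Finset (Fin P) := M.map (finRotate P).symm.toEmbedding

def RMi {P : ℕ} (M : Finset (Fin P)) : Finset (Fin P) := M.map (finRotate P).toEmbedding

lemma mem_RM {P : ℕ} (M : Finset (Fin P)) (i : Fin P) : i ∈ RM M ↔ finRotate P i ∈ M := by
  unfold RM
  rw [Finset.mem_map_equiv, Equiv.symm_symm]

lemma mem_RMi {P : ℕ} (M : Finset (Fin P)) (i : Fin P) :
    i ∈ RMi M ↔ (finRotate P).symm i ∈ M := by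
  unfold RMi
  rw [Finset.mem_map_equiv]

lemma ind_RM {P : ℕ} (M : Finset (Fin P)) (i : Fin P) : ind (RM M) i = ind M (finRotate P i) := by
  unfold ind
  by_cases h : finRotate P i ∈ M
  · rw [if_pos h, if_pos ((mem_RM M i).2 h)]
  · rw [if_neg h, if_neg (fun h2 => h ((mem_RM M i).1 h2))]

lemma RM_RMi {P : ℕ} (M : Finset (Fin P)) : RM (RMi M) = M := by
  ext i
  rw [mem_RM, mem_RMi, Equiv.symm_apply_apply]

lemma RMi_RM {P : ℕ} (M : Finset (Fin P)) : RMi (RM M) = M := by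
  ext i
  rw [mem_RMi, mem_RM, Equiv.apply_symm_apply]

lemma RZ_RZi {L P : ℕ} (Z : Fin P → ℤ) : RZ L (RZi L Z) = Z := by
  funext i
  show Z ((finRotate P).symm (finRotate P i)) - eps (finRotate P i) * L
    + eps (finRotate P i) * L = Z i
  rw [Equiv.symm_apply_apply]; ring

lemma GG_R {L P : ℕ} {Z : Fin P → ℤ} {M : Finset (Fin P)} (h : GG L Z M) :
    GG L (RZ L Z) (RM M) := by
  intro j
  have := h (finRotate P j)
  rw [Equiv.symm_apply_apply] at this
  rw [ind_RM]
  show Z (finRotate P ((finRotate P).symm j)) + eps (finRotate P ((finRotate P).symm j)) * L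
    + ind M (finRotate P ((finRotate P).symm j)) + 1 - eps j * L
    ≤ Z (finRotate P j) + eps (finRotate P j) * L
  rw [Equiv.apply_symm_apply]
  linarith

lemma GG_Ri {L P : ℕ} {Z : Fin P → ℤ} {M : Finset (Fin P)} (h : GG L Z M) :
    GG L (RZi L Z) (RMi M) := by
  intro j
  have := h ((finRotate P).symm j)
  have h2 : ind (RMi M) ((finRotate P).symm j) = ind M ((finRotate P).symm ((finRotate P).symm j)) := by
    conv_rhs => rw [← RM_RMi M]
    rw [ind_RM, Equiv.apply_symm_apply]
  rw [h2]
  show Z ((finRotate P).symm ((finRotate P).symm j)) - eps ((finRotate P).symm j) * L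
    + ind M ((finRotate P).symm ((finRotate P).symm j)) + 1 - eps j * L
    ≤ Z ((finRotate P).symm j) - eps j * L
  linarith

/-- the moved configuration -/
noncomputable def mv (L : ℕ) {P : ℕ} (Z : Fin P → ℤ) (M : Finset (Fin P)) : Fin P → ℤ :=
  fun i => if i ∈ M then succSite L (Z i) else Z i

noncomputable def fwd (L : ℕ) {P : ℕ} (z : Fin P) (X : Fin P → ℤ) (M : Finset (Fin P)) :
    (Fin P → ℤ) × Finset (Fin P) :=
  if X z - ind M z = 0 then (RZ L (fun i => X i - ind M i), RM M) else (fun i => X i - ind M i, M)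

noncomputable def bwd (L : ℕ) {P : ℕ} (z : Fin P) (p : (Fin P → ℤ) × Finset (Fin P)) :
    Finset (Fin P) :=
  if (finRotate P).symm z ∈ p.2 ∧ p.1 ((finRotate P).symm z) = L then RMi p.2 else p.2

def good (L : ℕ) {P : ℕ} (X : Fin P → ℤ) (p : (Fin P → ℤ) × Finset (Fin P)) : Prop :=
  IsConfig L P p.1 ∧ GG L p.1 p.2 ∧
    Finset.image X Finset.univ = Finset.image (mv L p.1 p.2) Finset.univ

lemma config_of {L P : ℕ} {z : Fin P} (hz : (z : ℕ) = 0) {Z : Fin P → ℤ} (h : cyc L Z)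
    (h1 : 1 ≤ Z z) (h2 : Z ((finRotate P).symm z) ≤ L) : IsConfig L P Z := by
  have hm := cyc_step h
  have hv := pr_val z
  have he : eps z = 1 := by unfold eps; rw [if_pos hz]
  rw [he] at hv
  refine ⟨hm, fun i => ⟨h1.trans (hm.monotone ?_), (hm.monotone ?_).trans h2⟩⟩
  · show (z : ℕ) ≤ i
    omega
  · show (i : ℕ) ≤ ((finRotate P).symm z : ℕ)
    have := i.2
    omega

lemma fwd_good {L P : ℕ} (hL : P < L) {z : Fin P} (hz : (z : ℕ) = 0) {X : Fin P → ℤ}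
    (hX : IsConfig L P X) {M : Finset (Fin P)} (hM : M ⊆ (frz L X)ᶜ) : good L X (fwd L z X M) := by
  have hH := (HH_iff (config_cyc hX) M).1 hM
  have hG := GG_of_HH hH
  have he : eps z = 1 := by unfold eps; rw [if_pos hz]
  have hXz := hX.2 z
  unfold fwd
  by_cases hw : X z - ind M z = 0
  · rw [if_pos hw]
    have hzM : z ∈ M ∧ X z = 1 := by
      rcases ind_cases M z with ⟨h1, h2⟩ | ⟨h1, h2⟩
      · exact ⟨h1, by omega⟩
      · omega
    have hG2 := GG_R hG
    refine ⟨config_of hz (cyc_of_GG hG2) ?_ ?_, hG2, ?_⟩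
    · have := hG (finRotate P z)
      rw [Equiv.symm_apply_apply] at this
      show 1 ≤ X (finRotate P z) - ind M (finRotate P z) + eps (finRotate P z) * L
      have h2 : X z - ind M z + ind M z + 1 - eps (finRotate P z) * L
        ≤ X (finRotate P z) - ind M (finRotate P z) := this
      omega
    · show X (finRotate P ((finRotate P).symm z)) - ind M (finRotate P ((finRotate P).symm z))
        + eps (finRotate P ((finRotate P).symm z)) * L ≤ L
      rw [Equiv.apply_symm_apply, he, hw]; omega
    · have : mv L (RZ L (fun i => X i - ind M i)) (RM M) = X ∘ finRotate P := by
        funext i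
        show (if i ∈ RM M then succSite L (X (finRotate P i) - ind M (finRotate P i)
            + eps (finRotate P i) * L) else X (finRotate P i) - ind M (finRotate P i)
            + eps (finRotate P i) * L) = X (finRotate P i)
        have hb := hX.2 (finRotate P i)
        rcases ind_cases M (finRotate P i) with ⟨h1, h2⟩ | ⟨h1, h2⟩
        · rw [if_pos ((mem_RM M i).2 h1), h2]
          unfold succSite
          rcases eps_cases (finRotate P i) with ⟨h3, h4⟩ | ⟨h3, h4⟩
          · have h5 : finRotate P i = z := Fin.ext (by omega)
            rw [h4, h5, if_pos (by omega)]; omega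
          · rw [h4, if_neg (by omega)]; omega
        · rw [if_neg (fun h => h1 ((mem_RM M i).1 h)), h2]
          rcases eps_cases (finRotate P i) with ⟨h3, h4⟩ | ⟨h3, h4⟩
          · have h5 : finRotate P i = z := Fin.ext (by omega)
            rw [h5] at h1
            exact absurd hzM.1 h1
          · rw [h4]; ring
      show _ = Finset.image (mv L (RZ L (fun i => X i - ind M i)) (RM M)) Finset.univ
      rw [this, ← Finset.image_image, Finset.image_univ_equiv]
  · rw [if_neg hw]
    refine ⟨config_of hz (cyc_of_GG hG) ?_ ?_, hG, ?_⟩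
    · show 1 ≤ X z - ind M z
      rcases ind_cases M z with ⟨h1, h2⟩ | ⟨h1, h2⟩ <;> omega
    · show X ((finRotate P).symm z) - ind M ((finRotate P).symm z) ≤ L
      have := (hX.2 ((finRotate P).symm z)).2
      rcases ind_cases M ((finRotate P).symm z) with ⟨h1, h2⟩ | ⟨h1, h2⟩ <;> omega
    · have : mv L (fun i => X i - ind M i) M = X := by
        funext i
        show (if i ∈ M then succSite L (X i - ind M i) else X i - ind M i) = X i
        have hb := hX.2 i
        rcases ind_cases M i with ⟨h1, h2⟩ | ⟨h1, h2⟩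
        · rw [if_pos h1, h2]
          unfold succSite
          rw [if_neg (by omega)]; omega
        · rw [if_neg h1, h2]; ring
      show _ = Finset.image (mv L (fun i => X i - ind M i) M) Finset.univ
      rw [this]

lemma mono_image {P : ℕ} {X W : Fin P → ℤ} (hX : StrictMono X) (hW : StrictMono W)
    (h : Finset.image X Finset.univ = Finset.image W Finset.univ) : X = W := by
  apply (StrictMono.range_inj hX hW).1
  have := congrArg (fun s : Finset ℤ => (s : Set ℤ)) h
  simpa using this

lemma bwd_nonwrap {L P : ℕ} {z : Fin P} (hz : (z : ℕ) = 0) {X Z : Fin P → ℤ}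
    {M : Finset (Fin P)} (hX : IsConfig L P X) (hg : good L X (Z, M))
    (hw : ¬ ((finRotate P).symm z ∈ M ∧ Z ((finRotate P).symm z) = L)) :
    X = fun i => Z i + ind M i := by
  obtain ⟨hZ, hG, him⟩ := hg
  replace hZ : IsConfig L P Z := hZ
  have hW := cyc_step (cyc_of_HH (HH_of_GG hG))
  apply mono_image hX.1 hW
  rw [him]
  congr 1
  funext i
  show (if i ∈ M then succSite L (Z i) else Z i) = Z i + ind M i
  rcases ind_cases M i with ⟨h1, h2⟩ | ⟨h1, h2⟩
  · rw [if_pos h1, h2]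
    unfold succSite
    rw [if_neg]
    intro h3
    apply hw
    have hv := pr_val z
    have he : eps z = 1 := by unfold eps; rw [if_pos hz]
    rw [he] at hv
    have : (finRotate P).symm z = i := by
      apply Fin.ext
      by_contra hne
      have : Z i < Z ((finRotate P).symm z) := hZ.1 (by
        show (i : ℕ) < ((finRotate P).symm z : ℕ)
        have := i.2
        omega)
      have := (hZ.2 ((finRotate P).symm z)).2
      omega
    rw [this]
    exact ⟨h1, h3⟩
  · rw [if_neg h1, h2]; ring

lemma bwd_wrap {L P : ℕ} {z : Fin P} (hz : (z : ℕ) = 0) {X Z : Fin P → ℤ}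
    {M : Finset (Fin P)} (hX : IsConfig L P X) (hg : good L X (Z, M))
    (hw : (finRotate P).symm z ∈ M ∧ Z ((finRotate P).symm z) = L) :
    X = fun i => RZi L Z i + ind (RMi M) i := by
  obtain ⟨hZ, hG, him⟩ := hg
  replace hZ : IsConfig L P Z := hZ
  have hW := cyc_step (cyc_of_HH (HH_of_GG (GG_Ri hG)))
  apply mono_image hX.1 hW
  have hv := pr_val z
  have he : eps z = 1 := by unfold eps; rw [if_pos hz]
  rw [he] at hv
  have : mv L Z M = (fun i => RZi L Z i + ind (RMi M) i) ∘ finRotate P := by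
    funext i
    show (if i ∈ M then succSite L (Z i) else Z i) = Z ((finRotate P).symm (finRotate P i))
      - eps (finRotate P i) * L + ind (RMi M) (finRotate P i)
    rw [Equiv.symm_apply_apply, ← ind_RM, RM_RMi]
    have hzi : (finRotate P i : ℕ) = 0 → (finRotate P).symm z = i := by
      intro h
      have : z = finRotate P i := Fin.ext (by omega)
      rw [this, Equiv.symm_apply_apply]
    rcases eps_cases (finRotate P i) with ⟨h3, h4⟩ | ⟨h3, h4⟩
    · have h5 := hzi h3
      rw [h5] at hw
      rcases ind_cases M i with ⟨h1, h2⟩ | ⟨h1, h2⟩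
      · rw [if_pos h1, h2, h4]
        unfold succSite
        rw [if_pos hw.2]; omega
      · exact absurd hw.1 h1
    · rcases ind_cases M i with ⟨h1, h2⟩ | ⟨h1, h2⟩
      · rw [if_pos h1, h2, h4]
        unfold succSite
        rw [if_neg]
        · ring
        · intro h6
          have : Z i = Z ((finRotate P).symm z) := by rw [h6, hw.2]
          have := hZ.1.injective this
          rw [this, Equiv.apply_symm_apply] at h3
          exact h3 hz
      · rw [if_neg h1, h2, h4]; ring
  rw [him]
  show Finset.image (mv L Z M) Finset.univ = _
  rw [this, ← Finset.image_image, Finset.image_univ_equiv]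

lemma bwd_sub {L P : ℕ} {z : Fin P} (hz : (z : ℕ) = 0) {X : Fin P → ℤ}
    {p : (Fin P → ℤ) × Finset (Fin P)} (hX : IsConfig L P X) (hg : good L X p) :
    bwd L z p ⊆ (frz L X)ᶜ := by
  obtain ⟨Z, M⟩ := p
  rw [HH_iff (config_cyc hX)]
  unfold bwd
  by_cases hw : (finRotate P).symm z ∈ M ∧ Z ((finRotate P).symm z) = L
  · rw [if_pos hw]
    have := bwd_wrap hz hX hg hw
    rw [this]
    exact HH_of_GG (GG_Ri hg.2.1)
  · rw [if_neg hw]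
    have := bwd_nonwrap hz hX hg hw
    rw [this]
    exact HH_of_GG hg.2.1

lemma fwd_bwd {L P : ℕ} {z : Fin P} (hz : (z : ℕ) = 0) {X : Fin P → ℤ}
    {p : (Fin P → ℤ) × Finset (Fin P)} (hX : IsConfig L P X) (hg : good L X p) :
    fwd L z X (bwd L z p) = p := by
  obtain ⟨Z, M⟩ := p
  have he : eps z = 1 := by unfold eps; rw [if_pos hz]
  have hZ : IsConfig L P Z := hg.1
  unfold bwd
  by_cases hw : (finRotate P).symm z ∈ M ∧ Z ((finRotate P).symm z) = L
  · rw [if_pos hw]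
    have := bwd_wrap hz hX hg hw
    have h2 : (fun i => X i - ind (RMi M) i) = RZi L Z := by
      funext i; rw [this]; ring
    have h3 : X z - ind (RMi M) z = 0 := by
      have := congrFun h2 z
      rw [show X z - ind (RMi M) z = RZi L Z z from this]
      unfold RZi
      rw [hw.2, he]; ring
    unfold fwd
    show (if X z - ind (RMi M) z = 0 then (RZ L (fun i => X i - ind (RMi M) i), RM (RMi M)) else
      (fun i => X i - ind (RMi M) i, RMi M)) = _
    rw [if_pos h3, h2, RM_RMi, RZ_RZi]
  · rw [if_neg hw]
    have := bwd_nonwrap hz hX hg hw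
    have h2 : (fun i => X i - ind M i) = Z := by
      funext i; rw [this]; ring
    have h3 : X z - ind M z ≠ 0 := by
      have := congrFun h2 z
      rw [show X z - ind M z = Z z from this]
      have := (hZ.2 z).1
      omega
    unfold fwd
    show (if X z - ind M z = 0 then (RZ L (fun i => X i - ind M i), RM M) else
      (fun i => X i - ind M i, M)) = _
    rw [if_neg h3, h2]

lemma bwd_fwd {L P : ℕ} {z : Fin P} (hz : (z : ℕ) = 0) {X : Fin P → ℤ}
    {M : Finset (Fin P)} (hX : IsConfig L P X) : bwd L z (fwd L z X M) = M := by
  have he : eps z = 1 := by unfold eps; rw [if_pos hz]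
  unfold fwd
  by_cases hw : X z - ind M z = 0
  · rw [if_pos hw]
    unfold bwd
    rw [if_pos, RMi_RM]
    constructor
    · show (finRotate P).symm z ∈ RM M
      rw [mem_RM, Equiv.apply_symm_apply]
      have := (hX.2 z).1
      rcases ind_cases M z with ⟨h1, h2⟩ | ⟨h1, h2⟩
      · exact h1
      · omega
    · show X (finRotate P ((finRotate P).symm z)) - ind M (finRotate P ((finRotate P).symm z))
        + eps (finRotate P ((finRotate P).symm z)) * L = L
      rw [Equiv.apply_symm_apply, hw, he]; ring
  · rw [if_neg hw]
    unfold bwd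
    rw [if_neg]
    rintro ⟨h1, h2⟩
    replace h1 : (finRotate P).symm z ∈ M := h1
    replace h2 : X ((finRotate P).symm z) - ind M ((finRotate P).symm z) = L := h2
    have := (hX.2 ((finRotate P).symm z)).2
    rcases ind_cases M ((finRotate P).symm z) with ⟨h3, h4⟩ | ⟨h3, h4⟩
    · omega
    · exact absurd h1 h3

lemma RM_card {P : ℕ} (M : Finset (Fin P)) : (RM M).card = M.card := Finset.card_map _

lemma fwd_card {L P : ℕ} {z : Fin P} {X : Fin P → ℤ} (M : Finset (Fin P)) :
    (fwd L z X M).2.card = M.card := by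
  unfold fwd
  split_ifs
  · exact RM_card M
  · rfl

lemma fwd_F {L P : ℕ} {z : Fin P} {X : Fin P → ℤ} (M : Finset (Fin P))
    (F : (Fin P → ℤ) → ℂ) (hF : ∀ Z, F (RZ L Z) = F Z) :
    F (fwd L z X M).1 = F (fun i => X i - ind M i) := by
  unfold fwd
  by_cases h : X z - ind M z = 0
  · rw [if_pos h]; exact hF (fun i => X i - ind M i)
  · rw [if_neg h]

noncomputable def cfgs (L P : ℕ) : Finset (Fin P → ℤ) :=
  (Fintype.piFinset fun _ : Fin P => Finset.Icc (1 : ℤ) L).filter (IsConfig L P)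

lemma mem_cfgs {L P : ℕ} (Z : Fin P → ℤ) : Z ∈ cfgs L P ↔ IsConfig L P Z := by
  unfold cfgs
  rw [Finset.mem_filter]
  refine ⟨fun h => h.2, fun h => ⟨?_, h⟩⟩
  rw [Fintype.mem_piFinset]
  intro i
  rw [Finset.mem_Icc]
  exact h.2 i

lemma T_apply {L P : ℕ} (hP : 1 ≤ P) (hL : P < L) (v γ : ℝ) (hv : 1 - v ≠ 0)
    {X : Fin P → ℤ} (hX : IsConfig L P X)
    (F : (Fin P → ℤ) → ℂ) (hF : ∀ Z, F (RZ L Z) = F Z) (u : (Fin P → ℤ) → ℝ)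
    (hu : ∀ Z, IsConfig L P Z → (u Z : ℂ) = (1 - v : ℂ) ^ ((P : ℤ) - Nc L Z) * F Z) :
    ((∑' Z, Tgamma v γ L P X Z * u Z : ℝ) : ℂ) =
      ∑ M ∈ (frz L X)ᶜ.powerset,
        Complex.exp (γ * M.card) * v ^ M.card * (1 - v : ℂ) ^ ((P : ℤ) - M.card) *
          F (fun i => X i - ind M i) := by
  have hv' : (1 - v : ℂ) ≠ 0 := by exact_mod_cast hv
  rw [tsum_eq_sum (s := cfgs L P)]
  swap
  · intro Z hZ
    rw [mem_cfgs] at hZ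
    unfold Tgamma
    rw [if_neg (fun h => hZ h.2), zero_mul]
  rw [Complex.ofReal_sum]
  have h1 : ∀ Z ∈ cfgs L P, ((Tgamma v γ L P X Z * u Z : ℝ) : ℂ) =
      ∑ M : Finset (Fin P), if good L X (Z, M) then
        Complex.exp (γ * M.card) * v ^ M.card * (1 - v : ℂ) ^ ((P : ℤ) - M.card) * F Z else 0 := by
    intro Z hZ
    rw [mem_cfgs] at hZ
    unfold Tgamma
    rw [if_pos ⟨hX, hZ⟩, Complex.ofReal_mul, hu Z hZ, Complex.ofReal_sum, Finset.sum_mul]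
    apply Finset.sum_congr rfl
    intro M _
    by_cases hg : good L X (Z, M)
    · rw [if_pos hg, if_pos ⟨(GG_iff hL hZ M).2 hg.2.1, hg.2.2⟩]
      push_cast
      have : (1 - v : ℂ) ^ ((P : ℤ) - M.card) =
        (1 - v : ℂ) ^ ((Nc L Z : ℤ) - M.card) * (1 - v : ℂ) ^ ((P : ℤ) - Nc L Z) := by
        rw [← zpow_add₀ hv']; congr 1; ring
      rw [this]; ring
    · rw [if_neg hg, if_neg, Complex.ofReal_zero, zero_mul]
      rintro ⟨h1, h2⟩
      exact hg ⟨hZ, (GG_iff hL hZ M).1 h1, h2⟩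
  rw [Finset.sum_congr rfl h1, ← Finset.sum_product', ← Finset.sum_filter]
  symm
  apply Finset.sum_bij' (fun M _ => fwd L ⟨0, hP⟩ X M) (fun p _ => bwd L ⟨0, hP⟩ p)
  · intro M hM
    rw [Finset.mem_powerset] at hM
    have := fwd_good hL (z := ⟨0, hP⟩) rfl hX hM
    rw [Finset.mem_filter, Finset.mem_product]
    exact ⟨⟨(mem_cfgs _).2 this.1, Finset.mem_univ _⟩, this⟩
  · intro p hp
    rw [Finset.mem_filter] at hp
    rw [Finset.mem_powerset]
    exact bwd_sub rfl hX hp.2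
  · intro M _
    exact bwd_fwd rfl hX
  · intro p hp
    rw [Finset.mem_filter] at hp
    exact fwd_bwd rfl hX hp.2
  · intro M _
    rw [fwd_card, fwd_F M F hF]

lemma summand_eq (lam r γ : ℝ) (L : ℕ) {P : ℕ} (X Y : Fin P → ℤ) (t : ℕ) (n : Fin P → ℤ) :
    summand1 lam r γ L X Y t n =
      (((1 : ℂ) + (lam : ℂ)) ^ (-(t : ℤ))) ^ P * sm (qq lam r γ) L Y (fun _ => (t : ℤ)) X n := by
  have key : ∀ σ : Equiv.Perm (Fin P),
      Complex.exp ((γ : ℂ) * ((∑ j, (X j - Y j + (L : ℤ) * n j) : ℤ) : ℂ)) *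
      (((Equiv.Perm.sign σ : ℤ) : ℂ) * ∏ i : Fin P, fInt lam r
        (((i : ℕ) : ℤ) - ((σ i : ℕ) : ℤ) + (P : ℤ) * n i - ∑ k, n k)
        (X i - Y (σ i) + n i * L) t) =
      (((1 : ℂ) + (lam : ℂ)) ^ (-(t : ℤ))) ^ P *
        tm (qq lam r γ) L Y (fun _ => (t : ℤ)) X n σ := by
    intro σ
    have h1 : (∑ j, (X j - Y j + (L : ℤ) * n j) : ℤ) = ∑ i, (X i - Y (σ i) + n i * L) := by
      simp only [Finset.sum_add_distrib, Finset.sum_sub_distrib]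
      rw [Equiv.sum_comp σ Y]
      congr 1
      exact Finset.sum_congr rfl fun i _ => mul_comm _ _
    rw [h1, Int.cast_sum, Finset.mul_sum, Complex.exp_sum]
    unfold tm qq
    rw [Finset.prod_mul_distrib]
    have h2 : ∀ i : Fin P, fInt lam r
        (((i : ℕ) : ℤ) - ((σ i : ℕ) : ℤ) + (P : ℤ) * n i - ∑ k, n k)
        (X i - Y (σ i) + n i * L) t = ((1 : ℂ) + (lam : ℂ)) ^ (-(t : ℤ)) *
        cI lam r ((t : ℤ) + (((i : ℕ) : ℤ) - ((σ i : ℕ) : ℤ) + (P : ℤ) * n i - ∑ k, n k))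
          (-(((i : ℕ) : ℤ) - ((σ i : ℕ) : ℤ) + (P : ℤ) * n i - ∑ k, n k))
          ((((i : ℕ) : ℤ) - ((σ i : ℕ) : ℤ) + (P : ℤ) * n i - ∑ k, n k)
            - (X i - Y (σ i) + n i * L) - 1) := fun i => rfl
    rw [Finset.prod_congr rfl fun i _ => h2 i, Finset.prod_mul_distrib, Finset.prod_const,
      Finset.card_univ, Fintype.card_fin]
    ring
  unfold summand1 sm
  have h3 : ∀ a b s : ℂ, a * b * s = b * (a * s) := fun a b s => by ring
  have h4 := Finset.sum_congr rfl fun σ (_ : σ ∈ Finset.univ) => key σ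
  rw [← Finset.mul_sum, ← Finset.mul_sum] at h4
  rw [h3, h4]
  ring

lemma main_ind {L P : ℕ} (hP : 1 ≤ P) (hL : P < L) {v γ r : ℝ} (hv0 : 0 < v) (hv1 : v < 1)
    (hr1 : 1 < r) (hr2 : v / (1 - v) * r < 1) (Y : Fin P → ℤ) (hY : IsConfig L P Y) (t : ℕ) :
    ∀ X, IsConfig L P X → ((Tgpow v γ L P t X Y : ℝ) : ℂ) =
      (1 - v : ℂ) ^ ((P : ℤ) - Nc L X) *
        ((1 - v : ℂ) ^ (t * P) * QQ (qq (v / (1 - v)) r γ) L Y (fun _ => (t : ℤ)) X) := by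
  have hlam : 0 < v / (1 - v) := div_pos hv0 (by linarith)
  have hq := qq_props γ hlam hr1 hr2
  have hvr : 1 - v ≠ 0 := by linarith
  have hv' : (1 - v : ℂ) ≠ 0 := by exact_mod_cast hvr
  have hc : (1 - v : ℂ) * (1 + ((v / (1 - v) : ℝ) : ℂ)) = 1 := by
    push_cast
    field_simp
    ring
  have hcard : ∀ X : Fin P → ℤ, IsConfig L P X →
      (1 - v : ℂ) ^ ((P : ℤ) - Nc L X) * (1 + ((v / (1 - v) : ℝ) : ℂ)) ^ (frz L X).card = 1 := by
    intro X hX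
    have h1 := frz_card hL hX
    have h2 : (P : ℤ) - Nc L X = ((frz L X).card : ℤ) := by omega
    rw [h2, zpow_natCast, ← mul_pow, hc, one_pow]
  induction t with
  | zero =>
    intro X hX
    have h1 := QQ_frz hq hP hL Y X (-1) le_rfl (frz L X) (Finset.Subset.refl _)
    rw [show (-1 : ℤ) + 1 = 0 by norm_num, QQ_init hq hP hL Y X hX hY] at h1
    rw [Nat.cast_zero, h1, zero_mul, pow_zero, one_mul, ← mul_assoc, hcard X hX, one_mul]
    show (((if X = Y then 1 else 0 : ℝ)) : ℂ) = _
    split_ifs <;> simp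
  | succ t ih =>
    intro X hX
    have h1 := QQ_frz hq hP hL Y X (t : ℤ) (by omega) (frz L X) (Finset.Subset.refl _)
    rw [QQ_ev hq hP hL Y X (t : ℤ) (by omega)] at h1
    have h2 := T_apply hP hL v γ hvr hX
      (fun Z => (1 - v : ℂ) ^ (t * P) * QQ (qq (v / (1 - v)) r γ) L Y (fun _ => (t : ℤ)) Z)
      (fun Z => by
        show _ * _ = _ * _
        congr 1
        exact QQ_rot _ hP Y Z t)
      (fun Z => Tgpow v γ L P t Z Y) ih
    show ((∑' Z, Tgamma v γ L P X Z * Tgpow v γ L P t Z Y : ℝ) : ℂ) = _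
    rw [h2, Nat.cast_succ, h1]
    have h3 : ∀ a b c d : ℂ, a * (b * (c * d)) = a * c * (b * d) := fun a b c d => by ring
    rw [h3, hcard X hX, one_mul, Finset.mul_sum]
    apply Finset.sum_congr rfl
    intro M _
    have h4 : Complex.exp (γ * M.card) = Complex.exp γ ^ M.card := by
      rw [← Complex.exp_nat_mul, mul_comm]
    have h5 : (1 - v : ℂ) ^ ((P : ℤ) - M.card) * (1 - v : ℂ) ^ M.card = (1 - v : ℂ) ^ P := by
      rw [← zpow_natCast, ← zpow_natCast, ← zpow_add₀ hv']
      congr 1; ring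
    have h6 : ((v / (1 - v) : ℝ) : ℂ) * (1 - v) = v := by
      push_cast
      field_simp
    have h7 : (v : ℂ) ^ M.card = ((v / (1 - v) : ℝ) : ℂ) ^ M.card * (1 - v : ℂ) ^ M.card := by
      rw [← mul_pow, h6]
    rw [h4, h7, mul_pow, show (t + 1) * P = t * P + P by ring, pow_add, ← h5]
    unfold ind
    ring

/-- the Bethe-ansatz formula for `(T_γ^t)(X,Y)`; only finitely many
summands over `n` are nonzero. -/
theorem stmt1 (L P : ℕ) (hP : 1 ≤ P) (hL : 2 * P ≤ L)
    (v : ℝ) (hv0 : 0 < v) (hv1 : v < 1 / 2) (γ : ℝ)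
    (r : ℝ) (hr1 : 1 < r) (hr2 : r < 1 / (v / (1 - v)))
    (t : ℕ) (X Y : Fin P → ℤ) (hX : IsConfig L P X) (hY : IsConfig L P Y) :
    {n : Fin P → ℤ | summand1 (v / (1 - v)) r γ L X Y t n ≠ 0}.Finite ∧
    ((Tgpow v γ L P t X Y : ℝ) : ℂ) =
      ((1 : ℂ) + ((v / (1 - v) : ℝ) : ℂ)) ^ ((Nc L X : ℤ) - P) *
        ∑' n : Fin P → ℤ, summand1 (v / (1 - v)) r γ L X Y t n := by
  have hPL : P < L := by omega
  have h1v : 0 < 1 - v := by linarith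
  have hlam : 0 < v / (1 - v) := div_pos hv0 h1v
  have hr3 : v / (1 - v) * r < 1 := by
    rw [lt_div_iff₀ hlam] at hr2
    linarith
  have hq := qq_props γ hlam hr1 hr3
  have hv' : (1 - v : ℂ) ≠ 0 := by exact_mod_cast h1v.ne'
  have hc : ((1 : ℂ) + ((v / (1 - v) : ℝ) : ℂ)) = (1 - v : ℂ)⁻¹ := by
    push_cast
    field_simp
    ring
  constructor
  · apply (tm_fin hq hP hPL Y (fun _ => (t : ℤ)) X (fun _ => by omega)
      ⟨⟨0, hP⟩, by omega⟩).subset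
    intro n hn h
    apply hn
    rw [summand_eq, h, mul_zero]
  · rw [main_ind hP hPL hv0 (by linarith) hr1 hr3 Y hY t X hX]
    rw [tsum_congr (summand_eq _ r γ L X Y t), tsum_mul_left, hc]
    congr 1
    · rw [inv_zpow', neg_sub]
    · congr 1
      rw [inv_zpow', neg_neg, zpow_natCast, ← pow_mul]
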